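/- arXiv:1904.06531 — 2 statements merged into one kernel-verified Lean document; each statement's English description precedes it below -/
import Mathlib

section
/- For every α ∈ (2γ, ∞), limsup_{n→∞} (1/n)·log λ{x ∈ (0,1) irrational : (2/n)·log q_n(x) ≥ α} ≤ −I(α). -/
open Filter MeasureTheory Set

/-- The Gauss map `T x = 1/x - ⌊1/x⌋`. -/
noncomputable def gaussMap (x : ℝ) : ℝ := Int.fract (1 / x)

/-- The `(i+1)`-st continued fraction digit `a_{i+1}(x) = ⌊1 / T^i x⌋`. -/
noncomputable def cfDigit (x : ℝ) (i : ℕ) : ℕ := ⌊1 / (gaussMap^[i] x)⌋₊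

/-- Denominators of the convergents: `q_0 = 1`, `q_1 = a_1`, `q_n = a_n q_{n-1} + q_{n-2}`,
given the digit sequence `a` (indexed so that `a i` is the `(i+1)`-st digit). -/
def contDen (a : ℕ → ℕ) : ℕ → ℕ
  | 0 => 1
  | 1 => a 0
  | (n + 2) => a (n + 1) * contDen a (n + 1) + contDen a n

/-- Numerators of the convergents: `p_0 = 0`, `p_1 = 1`, `p_n = a_n p_{n-1} + p_{n-2}`. -/
def contNum (a : ℕ → ℕ) : ℕ → ℕ
  | 0 => 0
  | 1 => 1
  | (n + 2) => a (n + 1) * contNum a (n + 1) + contNum a n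

/-- `q_n(x)`, the denominator of the `n`-th convergent of `x`. -/
noncomputable def qDen (n : ℕ) (x : ℝ) : ℕ := contDen (cfDigit x) n

/-- The level set `L(α)` of the Lyapunov exponent: irrationals `x ∈ (0,1)` with
`liminf (2/n) log q_n(x) = limsup (2/n) log q_n(x) = α`. -/
noncomputable def levelSet (α : EReal) : Set ℝ :=
  {x | x ∈ Set.Ioo (0 : ℝ) 1 ∧ Irrational x ∧
    Filter.liminf (fun n : ℕ => ((2 / (n : ℝ) * Real.log (qDen n x) : ℝ) : EReal))
      Filter.atTop = α ∧
    Filter.limsup (fun n : ℕ => ((2 / (n : ℝ) * Real.log (qDen n x) : ℝ) : EReal))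
      Filter.atTop = α}

/-- `b(α)`, the Hausdorff dimension of the level set `L(α)`. -/
noncomputable def dimSpec (α : ℝ) : ℝ := (dimH (levelSet (α : EReal))).toReal

/-- The rate function `I(α) = α (1 - b(α))`. -/
noncomputable def rateI (α : ℝ) : ℝ := α * (1 - dimSpec α)

/-- Lévy's constant `γ = π² / (12 log 2)`. -/
noncomputable def levyConst : ℝ := Real.pi ^ 2 / (12 * Real.log 2)

/-- `α_min = log ((√5 + 1)/2)`. -/
noncomputable def alphaMin : ℝ := Real.log ((Real.sqrt 5 + 1) / 2)

open Topology

/-- `x` is the forward orbit under the Gauss map of the number with digits `d`. -/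
def IsCFOrbit (d : ℕ → ℕ) (x : ℕ → ℝ) : Prop :=
  ∀ i, x i ∈ Ioo (0 : ℝ) 1 ∧ x i * (d i + x (i + 1)) = 1

theorem isCFOrbit_of_irrational {x : ℝ} (hx : x ∈ Ioo (0 : ℝ) 1) (hirr : Irrational x) :
    IsCFOrbit (cfDigit x) (fun i => gaussMap^[i] x) := by
  have key : ∀ i, gaussMap^[i] x ∈ Ioo (0 : ℝ) 1 ∧ Irrational (gaussMap^[i] x) := by
    intro i
    induction i with
    | zero => exact ⟨hx, hirr⟩
    | succ i ih =>
      rw [Function.iterate_succ_apply']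
      set y := gaussMap^[i] x
      have h1 : Irrational (1 / y) := by simpa using ih.2.inv
      have h2 : Irrational (gaussMap y) := by
        unfold gaussMap Int.fract
        exact h1.sub_intCast _
      refine ⟨⟨?_, Int.fract_lt_one _⟩, h2⟩
      exact lt_of_le_of_ne (Int.fract_nonneg _) (fun h => h2.ne_zero h.symm)
  intro i
  refine ⟨(key i).1, ?_⟩
  have h0 := (key i).1.1
  simp only [Function.iterate_succ_apply', cfDigit]
  set y := gaussMap^[i] x
  have : ((⌊1 / y⌋₊ : ℕ) : ℝ) + gaussMap y = 1 / y := by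
    rw [gaussMap, natCast_floor_eq_intCast_floor (by positivity)]
    exact Int.floor_add_fract _
  rw [this]
  field_simp

namespace IsCFOrbit

variable {d e : ℕ → ℕ} {x y : ℕ → ℝ}

theorem one_le_digit (h : IsCFOrbit d x) (i : ℕ) : 1 ≤ d i := by
  by_contra hd
  have hd0 : d i = 0 := by omega
  have h1 := h i
  have h2 := (h (i + 1)).1
  rw [hd0] at h1
  have := h1.1.1
  have := h1.1.2
  have := h1.2
  have := h2.1
  have := h2.2
  push_cast at *
  nlinarith

theorem one_div_eq (h : IsCFOrbit d x) (i : ℕ) : 1 / x i = d i + x (i + 1) := by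
  have h1 := h i
  have : x i ≠ 0 := h1.1.1.ne'
  field_simp
  linarith [h1.2]

theorem iterate_gaussMap (h : IsCFOrbit d x) (i : ℕ) : gaussMap^[i] (x 0) = x i := by
  induction i with
  | zero => rfl
  | succ i ih =>
    rw [Function.iterate_succ_apply', ih, gaussMap, h.one_div_eq, Int.fract_natCast_add]
    exact Int.fract_eq_self.2 ⟨(h _).1.1.le, (h _).1.2⟩

theorem cfDigit_eq (h : IsCFOrbit d x) (i : ℕ) : cfDigit (x 0) i = d i := by
  have := (h (i + 1)).1
  rw [cfDigit, h.iterate_gaussMap, h.one_div_eq,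
    Nat.floor_eq_iff (add_nonneg (Nat.cast_nonneg _) this.1.le)]
  exact ⟨by linarith [this.1], by linarith [this.2]⟩

theorem prod_eq (h : IsCFOrbit d x) (n : ℕ) :
    ∏ i ∈ Finset.range (n + 1), (d i + x (i + 1))
      = contDen d (n + 1) + contDen d n * x (n + 1) := by
  induction n with
  | zero => simp [contDen]
  | succ n ih =>
    rw [Finset.prod_range_succ, ih, contDen]
    push_cast
    linear_combination (contDen d n : ℝ) * (h (n + 1)).2

theorem dist_mul_prod (hx : IsCFOrbit d x) (hy : IsCFOrbit e y) (n : ℕ)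
    (hde : ∀ i < n, d i = e i) :
    |x 0 - y 0| * (∏ i ∈ Finset.range n, (d i + x (i + 1)))
      * (∏ i ∈ Finset.range n, (e i + y (i + 1))) = |x n - y n| := by
  induction n with
  | zero => simp
  | succ n ih =>
    have ih := ih fun i hi => hde i (by omega)
    rw [Finset.prod_range_succ, Finset.prod_range_succ]
    have h1 : 0 < d n + x (n + 1) := by have := (hx (n + 1)).1.1; positivity
    have h2 : 0 < e n + y (n + 1) := by have := (hy (n + 1)).1.1; positivity
    have h3 : |x n - y n| * ((d n + x (n + 1)) * (e n + y (n + 1))) = |x (n + 1) - y (n + 1)| := by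
      rw [← abs_of_pos (mul_pos h1 h2), ← abs_mul, abs_sub_comm (x (n + 1))]
      congr 1
      have hd := hde n (by omega)
      have hx2 := (hx n).2
      have hy2 := (hy n).2
      rw [hd] at hx2 ⊢
      linear_combination (e n + y (n + 1)) * hx2 - (e n + x (n + 1)) * hy2
    rw [← h3, ← ih]
    ring

end IsCFOrbit

theorem contDen_pos {d : ℕ → ℕ} (hd : ∀ i, 1 ≤ d i) (n : ℕ) : 0 < contDen d n := by
  induction n using Nat.twoStepInduction with
  | zero => simp [contDen]
  | one => exact hd 0
  | more n _ _ => rw [contDen]; positivity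

theorem contDen_le_succ {d : ℕ → ℕ} (hd : ∀ i, 1 ≤ d i) (n : ℕ) :
    contDen d n ≤ contDen d (n + 1) := by
  cases n with
  | zero => exact hd 0
  | succ n => rw [contDen]; nlinarith [hd (n + 1), contDen_pos hd (n + 1)]

theorem contDen_monotone {d : ℕ → ℕ} (hd : ∀ i, 1 ≤ d i) : Monotone (contDen d) :=
  monotone_nat_of_le_succ (contDen_le_succ hd)

theorem contDen_congr {d e : ℕ → ℕ} {n : ℕ} (h : ∀ i < n, d i = e i) :
    contDen d n = contDen e n := by
  induction n using Nat.twoStepInduction with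
  | zero => rfl
  | one => exact h 0 one_pos
  | more n h1 h2 =>
    rw [contDen, contDen, h1 fun i hi => h i (by omega), h2 fun i hi => h i (by omega),
      h (n + 1) (by omega)]

theorem contDen_le_pow {d : ℕ → ℕ} {M n : ℕ} (hd : ∀ i < n, d i ≤ M) :
    contDen d n ≤ (M + 1) ^ n := by
  induction n using Nat.twoStepInduction with
  | zero => simp [contDen]
  | one => have := hd 0 one_pos; simp [contDen]; omega
  | more n h1 h2 =>
    have h1 := h1 fun i hi => hd i (by omega)
    have h2 := h2 fun i hi => hd i (by omega)
    rw [contDen]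
    calc _ ≤ M * (M + 1) ^ (n + 1) + (M + 1) ^ n := by
          gcongr; exact hd _ (by omega)
      _ ≤ M * (M + 1) ^ (n + 1) + (M + 1) ^ (n + 1) := by
          gcongr <;> omega
      _ = _ := by ring

theorem contDen_add_ge {d : ℕ → ℕ} (k n : ℕ) :
    contDen d k * contDen (fun i => d (k + i)) n ≤ contDen d (k + n) := by
  induction n using Nat.twoStepInduction with
  | zero => simp [contDen]
  | one =>
    cases k with
    | zero => simp [contDen]
    | succ k => simp only [contDen, add_zero]; nlinarith
  | more n h1 h2 =>
    rw [show k + (n + 2) = (k + n) + 2 by ring, contDen, contDen]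
    rw [show k + (n + 1) = k + n + 1 by ring] at *
    nlinarith

theorem contDen_add_le {d : ℕ → ℕ} (hd : ∀ i, 1 ≤ d i) (k n : ℕ) :
    contDen d (k + n) ≤ 2 * (contDen d k * contDen (fun i => d (k + i)) n) := by
  induction n using Nat.twoStepInduction with
  | zero => simp [contDen]; omega
  | one =>
    cases k with
    | zero => simp [contDen]; omega
    | succ k =>
      simp only [contDen, add_zero]
      have h1 := contDen_le_succ hd k
      have h2 := hd (k + 1)
      nlinarith [Nat.zero_le (contDen d (k + 1))]
  | more n h1 h2 =>
    rw [show k + (n + 2) = (k + n) + 2 by ring, contDen, contDen]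
    rw [show k + (n + 1) = k + n + 1 by ring] at *
    nlinarith

namespace IsCFOrbit

variable {d e : ℕ → ℕ} {x y : ℕ → ℝ}

theorem prod_nonneg (h : IsCFOrbit d x) (n : ℕ) :
    0 ≤ ∏ i ∈ Finset.range n, (d i + x (i + 1)) :=
  Finset.prod_nonneg fun i _ => by have := (h (i + 1)).1.1; positivity

theorem contDen_le_prod (h : IsCFOrbit d x) (n : ℕ) :
    (contDen d n : ℝ) ≤ ∏ i ∈ Finset.range n, (d i + x (i + 1)) := by
  cases n with
  | zero => simp [contDen]
  | succ n =>
    rw [h.prod_eq]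
    have := (h (n + 1)).1.1
    have : 0 ≤ contDen d n * x (n + 1) := by positivity
    linarith

theorem prod_le_contDen (h : IsCFOrbit d x) (n : ℕ) :
    ∏ i ∈ Finset.range n, (d i + x (i + 1)) ≤ 2 * contDen d n := by
  cases n with
  | zero => simp [contDen]
  | succ n =>
    rw [h.prod_eq]
    have h1 := (h (n + 1)).1
    have h2 : (contDen d n : ℝ) ≤ contDen d (n + 1) := by
      exact_mod_cast contDen_le_succ h.one_le_digit n
    have h3 : (0 : ℝ) ≤ contDen d n := by positivity
    nlinarith [h1.1, h1.2]

theorem log_contDen_le (h : IsCFOrbit d x) (n : ℕ) :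
    Real.log (contDen d n) ≤ ∑ i ∈ Finset.range n, -Real.log (x i) := by
  have h0 : (0 : ℝ) < contDen d n := by exact_mod_cast contDen_pos h.one_le_digit n
  refine (Real.log_le_log h0 (h.contDen_le_prod n)).trans ?_
  rw [Real.log_prod]
  · apply le_of_eq
    refine Finset.sum_congr rfl fun i _ => ?_
    rw [← h.one_div_eq, one_div, Real.log_inv]
  · intro i _
    have := (h (i + 1)).1.1
    positivity

theorem abs_sub_le (hx : IsCFOrbit d x) (hy : IsCFOrbit e y) (n : ℕ)
    (hde : ∀ i < n, d i = e i) : |x 0 - y 0| ≤ 1 / (contDen d n : ℝ) ^ 2 := by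
  have h := hx.dist_mul_prod hy n hde
  have hq := contDen_congr hde
  have h1 := hx.contDen_le_prod n
  have h2 := hy.contDen_le_prod n
  rw [← hq] at h2
  have h0 : (0 : ℝ) < contDen d n := by exact_mod_cast contDen_pos hx.one_le_digit n
  have h3 : |x n - y n| ≤ 1 := by
    have := (hx n).1
    have := (hy n).1
    rw [abs_le]
    constructor <;> linarith [(hx n).1.1, (hx n).1.2, (hy n).1.1, (hy n).1.2]
  have hp := hx.prod_nonneg n
  rw [le_div_iff₀ (by positivity)]
  calc |x 0 - y 0| * (contDen d n : ℝ) ^ 2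
      = |x 0 - y 0| * contDen d n * contDen d n := by ring
    _ ≤ _ := by gcongr
    _ ≤ 1 := h.trans_le h3

theorem one_div_le (h : IsCFOrbit d x) {M : ℕ} (hM : ∀ i, d i ≤ M) (i : ℕ) :
    1 / ((M : ℝ) + 1) ≤ x i := by
  have h1 := h i
  have h2 := (h (i + 1)).1
  have h3 : (d i : ℝ) ≤ M := by exact_mod_cast hM i
  have h4 := h1.1.1
  rw [div_le_iff₀ (by positivity)]
  nlinarith [h1.2, h2.2]

theorem le_abs_sub (hx : IsCFOrbit d x) (hy : IsCFOrbit e y) {M : ℕ} (hdM : ∀ i, d i ≤ M)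
    (heM : ∀ i, e i ≤ M) {n : ℕ} (hde : ∀ i < n, d i = e i) (hne : d n ≠ e n) :
    1 / (4 * ((M : ℝ) + 1) ^ 3 * (contDen d n : ℝ) ^ 2) ≤ |x 0 - y 0| := by
  have h := hx.dist_mul_prod hy n hde
  have hq := contDen_congr hde
  have h1 := hx.prod_le_contDen n
  have h2 := hy.prod_le_contDen n
  rw [← hq] at h2
  have hc : 1 / ((M : ℝ) + 1) ^ 3 ≤ |x n - y n| := by
    have hm : (0 : ℝ) < M + 1 := by positivity
    have hu := hx.one_div_le hdM (n + 1)
    have hv := hy.one_div_le heM (n + 1)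
    have hu1 := (hx (n + 1)).1
    have hv1 := (hy (n + 1)).1
    have ha : (0 : ℝ) < d n + x (n + 1) := by have := hu1.1; positivity
    have hb : (0 : ℝ) < e n + y (n + 1) := by have := hv1.1; positivity
    have ha' : (d n + x (n + 1)) ≤ (M : ℝ) + 1 := by
      have : (d n : ℝ) ≤ M := by exact_mod_cast hdM n
      linarith [hu1.2]
    have hb' : (e n + y (n + 1)) ≤ (M : ℝ) + 1 := by
      have : (e n : ℝ) ≤ M := by exact_mod_cast heM n
      linarith [hv1.2]
    have hgap : 1 / ((M : ℝ) + 1) ≤ |(d n + x (n + 1)) - (e n + y (n + 1))| := by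
      rcases lt_or_gt_of_ne hne with hlt | hlt
      · have : (d n : ℝ) + 1 ≤ e n := by exact_mod_cast hlt
        rw [abs_sub_comm]
        exact le_trans (by linarith [hu1.2, hv]) (le_abs_self _)
      · have : (e n : ℝ) + 1 ≤ d n := by exact_mod_cast hlt
        exact le_trans (by linarith [hv1.2, hu]) (le_abs_self _)
    have hid : |x n - y n| * ((d n + x (n + 1)) * (e n + y (n + 1)))
        = |(d n + x (n + 1)) - (e n + y (n + 1))| := by
      rw [← abs_of_pos (mul_pos ha hb), ← abs_mul, abs_sub_comm (d n + x (n + 1))]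
      congr 1
      linear_combination (e n + y (n + 1)) * (hx n).2 - (d n + x (n + 1)) * (hy n).2
    rw [div_le_iff₀ (by positivity)]
    rw [div_le_iff₀ hm] at hgap
    calc (1 : ℝ) ≤ |x n - y n| * ((d n + x (n + 1)) * (e n + y (n + 1))) * (M + 1) := by
          rw [hid]; exact hgap
      _ ≤ |x n - y n| * ((M + 1) * (M + 1)) * (M + 1) := by gcongr
      _ = _ := by ring
  have h0 : (0 : ℝ) < contDen d n := by exact_mod_cast contDen_pos hx.one_le_digit n
  have hp1 := hx.prod_nonneg n
  have hp2 := hy.prod_nonneg n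
  rw [div_le_iff₀ (by positivity)] at hc ⊢
  calc (1 : ℝ) ≤ |x n - y n| * (M + 1) ^ 3 := hc
    _ = |x 0 - y 0| * (∏ i ∈ Finset.range n, (d i + x (i + 1)))
      * (∏ i ∈ Finset.range n, (e i + y (i + 1))) * (M + 1) ^ 3 := by rw [h]
    _ ≤ |x 0 - y 0| * (2 * contDen d n) * (2 * contDen d n) * (M + 1) ^ 3 := by gcongr
    _ = _ := by ring

end IsCFOrbit

/-- The `n`-th convergent of the continued fraction with digits `d`. -/
noncomputable def cfApprox : ℕ → (ℕ → ℕ) → ℝ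
  | 0, _ => 0
  | n + 1, d => 1 / (d 0 + cfApprox n (fun i => d (i + 1)))

/-- The value of the infinite continued fraction with digits `d`. -/
noncomputable def cfValue (d : ℕ → ℕ) : ℝ := limsup (fun n => cfApprox n d) atTop

theorem measurable_cfApprox (n : ℕ) : Measurable (cfApprox n) := by
  induction n with
  | zero => exact measurable_const
  | succ n ih =>
    have h1 : Measurable fun d : ℕ → ℕ => cfApprox n fun i => d (i + 1) :=
      ih.comp (measurable_pi_lambda _ fun i => measurable_pi_apply (i + 1))
    have h2 : Measurable fun d : ℕ → ℕ => (d 0 : ℝ) :=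
      measurable_from_top.comp (measurable_pi_apply 0)
    exact measurable_const.div (h2.add h1)

theorem measurable_cfValue : Measurable cfValue :=
  Measurable.limsup measurable_cfApprox

theorem cfApprox_mem_Icc {d : ℕ → ℕ} (hd : ∀ i, 1 ≤ d i) (n : ℕ) :
    cfApprox n d ∈ Icc (0 : ℝ) 1 := by
  induction n generalizing d with
  | zero => simp [cfApprox]
  | succ n ih =>
    have h := ih (d := fun i => d (i + 1)) fun i => hd _
    have h0 : (1 : ℝ) ≤ d 0 := by exact_mod_cast hd 0
    rw [cfApprox]
    constructor
    · have := h.1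
      positivity
    · rw [div_le_one] <;> linarith [h.1]

theorem abs_one_div_sub_one_div_le {a b s t : ℝ} (ha : 1 ≤ a) (hb : 1 ≤ b) (hs : 0 ≤ s)
    (ht : 0 ≤ t) :
    |1 / (a + 1 / (b + s)) - 1 / (a + 1 / (b + t))| ≤ 1 / 4 * |s - t| := by
  have h1 : 1 / (a + 1 / (b + s)) - 1 / (a + 1 / (b + t))
      = (s - t) / ((a * (b + s) + 1) * (a * (b + t) + 1)) := by
    have := mul_nonneg (zero_le_one.trans ha) (add_nonneg (zero_le_one.trans hb) hs)
    have := mul_nonneg (zero_le_one.trans ha) (add_nonneg (zero_le_one.trans hb) ht)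
    field_simp
    ring
  have h2 : 2 ≤ a * (b + s) + 1 := by nlinarith
  have h3 : 2 ≤ a * (b + t) + 1 := by nlinarith
  have h4 : 4 ≤ (a * (b + s) + 1) * (a * (b + t) + 1) := by nlinarith
  rw [h1, abs_div, abs_of_pos (by linarith : 0 < (a * (b + s) + 1) * (a * (b + t) + 1)),
    div_le_iff₀ (by linarith)]
  nlinarith [abs_nonneg (s - t)]

theorem abs_cfApprox_sub_le (k : ℕ) {d : ℕ → ℕ} (hd : ∀ i, 1 ≤ d i) {m n : ℕ}
    (hm : 2 * k ≤ m) (hn : 2 * k ≤ n) :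
    |cfApprox m d - cfApprox n d| ≤ (1 / 4 : ℝ) ^ k := by
  induction k generalizing d m n with
  | zero =>
    have h1 := cfApprox_mem_Icc hd m
    have h2 := cfApprox_mem_Icc hd n
    rw [pow_zero, abs_le]
    constructor <;> linarith [h1.1, h1.2, h2.1, h2.2]
  | succ k ih =>
    obtain ⟨m, rfl⟩ : ∃ m', m = m' + 2 := ⟨m - 2, by omega⟩
    obtain ⟨n, rfl⟩ : ∃ n', n = n' + 2 := ⟨n - 2, by omega⟩
    simp only [cfApprox]
    have hd' : ∀ i, 1 ≤ d (i + 1 + 1) := fun i => hd _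
    refine (abs_one_div_sub_one_div_le (by exact_mod_cast hd 0) (by exact_mod_cast hd 1)
      (cfApprox_mem_Icc hd' m).1 (cfApprox_mem_Icc hd' n).1).trans ?_
    have := ih hd' (m := m) (n := n) (by omega) (by omega)
    rw [pow_succ]
    linarith

theorem tendsto_cfApprox {d : ℕ → ℕ} (hd : ∀ i, 1 ≤ d i) :
    Tendsto (fun n => cfApprox n d) atTop (𝓝 (cfValue d)) := by
  have hc : CauchySeq fun n => cfApprox n d := by
    rw [Metric.cauchySeq_iff]
    intro ε hε
    obtain ⟨k, hk⟩ := exists_pow_lt_of_lt_one hε (by norm_num : (1 / 4 : ℝ) < 1)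
    exact ⟨2 * k, fun m hm n hn => (abs_cfApprox_sub_le k hd hm hn).trans_lt hk⟩
  obtain ⟨l, hl⟩ := cauchySeq_tendsto_of_complete hc
  rwa [cfValue, hl.limsup_eq]

theorem isCFOrbit_cfValue {d : ℕ → ℕ} (hd : ∀ i, 1 ≤ d i) :
    IsCFOrbit d (fun i => cfValue fun j => d (i + j)) := by
  have hIcc : ∀ i, cfValue (fun j => d (i + j)) ∈ Icc (0 : ℝ) 1 := fun i =>
    isClosed_Icc.mem_of_tendsto (tendsto_cfApprox fun j => hd _)
      (Eventually.of_forall fun n => cfApprox_mem_Icc (fun j => hd _) n)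
  have hpos : ∀ i, 0 < (d i : ℝ) + cfValue (fun j => d (i + 1 + j)) := fun i => by
    have := (hIcc (i + 1)).1
    have : (1 : ℝ) ≤ d i := by exact_mod_cast hd i
    linarith
  have hrec : ∀ i, cfValue (fun j => d (i + j))
      = 1 / (d i + cfValue (fun j => d (i + 1 + j))) := fun i => by
    have h1 := (tendsto_add_atTop_iff_nat 1).2
      (tendsto_cfApprox (d := fun j => d (i + j)) fun j => hd _)
    have h2 := tendsto_cfApprox (d := fun j => d (i + 1 + j)) fun j => hd _
    have h3 : Tendsto (fun n => cfApprox (n + 1) (fun j => d (i + j))) atTop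
        (𝓝 (1 / (d i + cfValue (fun j => d (i + 1 + j))))) := by
      have := (h2.const_add (d i : ℝ)).inv₀ (hpos i).ne'
      simpa [cfApprox, add_assoc, add_comm, add_left_comm] using this
    exact tendsto_nhds_unique h1 h3
  have hpos' : ∀ i, 0 < cfValue (fun j => d (i + j)) := fun i => by
    rw [hrec]
    exact one_div_pos.2 (hpos i)
  intro i
  refine ⟨⟨hpos' i, ?_⟩, ?_⟩
  · simp only
    rw [hrec, div_lt_one (hpos i)]
    have : (1 : ℝ) ≤ d i := by exact_mod_cast hd i
    linarith [hpos' (i + 1)]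
  · simp only
    rw [hrec i]
    exact one_div_mul_cancel (hpos i).ne'

theorem measurable_gaussMap : Measurable gaussMap :=
  measurable_fract.comp (measurable_const.div measurable_id)

theorem measurable_cfDigit (i : ℕ) : Measurable fun x => cfDigit x i :=
  Nat.measurable_floor.comp (measurable_const.div (measurable_gaussMap.iterate i))

theorem measurable_contDen {Ω : Type*} [MeasurableSpace Ω] {d : Ω → ℕ → ℕ}
    (hd : ∀ i, Measurable fun ω => d ω i) (n : ℕ) : Measurable fun ω => contDen (d ω) n := by
  induction n using Nat.twoStepInduction with
  | zero => exact measurable_const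
  | one => exact hd 0
  | more n h1 h2 => exact ((hd (n + 1)).mul h2).add h1

theorem measurable_qDen (n : ℕ) : Measurable (qDen n) :=
  measurable_contDen measurable_cfDigit n

theorem measurable_log_qDen (n : ℕ) : Measurable fun x => Real.log (qDen n x) :=
  Real.measurable_log.comp (measurable_from_top.comp (measurable_qDen n))

theorem measurableSet_irrational : MeasurableSet {x : ℝ | Irrational x} :=
  (countable_range ((↑) : ℚ → ℝ)).measurableSet.compl

theorem ae_irrational : ∀ᵐ x : ℝ, Irrational x := by
  rw [ae_iff]
  simp only [Irrational, not_not]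
  exact (countable_range ((↑) : ℚ → ℝ)).measure_zero volume

/-- Cylinders are no longer than the inverse square of the denominator. -/
theorem volume_cylinder_le {n : ℕ} {a : ℕ → ℕ} {A : Set ℝ}
    (hA : ∀ x ∈ A, x ∈ Ioo (0 : ℝ) 1 ∧ Irrational x) :
    volume (A ∩ {x | ∀ i < n, cfDigit x i = a i})
      ≤ ENNReal.ofReal (1 / (contDen a n : ℝ) ^ 2) := by
  refine (Real.volume_le_diam _).trans ?_
  refine Metric.ediam_le fun x hx y hy => ?_
  rw [edist_dist]
  refine ENNReal.ofReal_le_ofReal ?_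
  rw [Real.dist_eq, ← contDen_congr hx.2]
  exact (isCFOrbit_of_irrational (hA x hx.1).1 (hA x hx.1).2).abs_sub_le
    (isCFOrbit_of_irrational (hA y hy.1).1 (hA y hy.1).2) n fun i hi => by
      rw [hx.2 i hi, hy.2 i hi]

/-- Concatenation of blocks of `n` digits: the `i`-th block consists of the first digits of
`(ω i).1` if the denominator produced so far is less than `θ ^ i`, and of `(ω i).2` otherwise.
Only the first `n * i` values of `greedyPrefix n θ ω i` are meaningful. -/
noncomputable def greedyPrefix (n : ℕ) (θ : ℝ) (ω : ℕ → ℝ × ℝ) : ℕ → ℕ → ℕ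
  | 0, _ => 1
  | i + 1, j =>
    if j < n * i then greedyPrefix n θ ω i j
    else cfDigit (if (contDen (greedyPrefix n θ ω i) (n * i) : ℝ) < θ ^ i then (ω i).1
      else (ω i).2) (j - n * i)

/-- The digit sequence obtained by greedy concatenation of blocks. -/
noncomputable def greedyDigits (n : ℕ) (θ : ℝ) (ω : ℕ → ℝ × ℝ) (j : ℕ) : ℕ :=
  greedyPrefix n θ ω (j + 1) j

/-- The number whose first digits form the `i`-th block of the greedy concatenation. -/
noncomputable def greedyPick (n : ℕ) (θ : ℝ) (ω : ℕ → ℝ × ℝ) (i : ℕ) : ℝ :=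
  if (contDen (greedyDigits n θ ω) (n * i) : ℝ) < θ ^ i then (ω i).1 else (ω i).2

section Greedy

variable {n : ℕ} {θ : ℝ} {ω : ℕ → ℝ × ℝ}

theorem greedyPrefix_add {i j : ℕ} (hj : j < n * i) (k : ℕ) :
    greedyPrefix n θ ω (i + k) j = greedyPrefix n θ ω i j := by
  induction k with
  | zero => rfl
  | succ k ih =>
    rw [← add_assoc, greedyPrefix, if_pos (by nlinarith), ih]

theorem greedyDigits_eq_prefix {i j : ℕ} (hj : j < n * i) :
    greedyDigits n θ ω j = greedyPrefix n θ ω i j := by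
  have hn : 0 < n := by
    rcases Nat.eq_zero_or_pos n with h | h
    · simp [h] at hj
    · exact h
  have hj' : j < n * (j + 1) := by nlinarith
  rcases le_total i (j + 1) with h | h
  · obtain ⟨k, hk⟩ := Nat.exists_eq_add_of_le h
    rw [greedyDigits, hk, greedyPrefix_add hj]
  · obtain ⟨k, hk⟩ := Nat.exists_eq_add_of_le h
    rw [greedyDigits, hk, greedyPrefix_add hj']

theorem contDen_greedyPrefix (i : ℕ) :
    contDen (greedyPrefix n θ ω i) (n * i) = contDen (greedyDigits n θ ω) (n * i) :=
  contDen_congr fun _ hj => (greedyDigits_eq_prefix hj).symm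

theorem greedyDigits_block (i : ℕ) {r : ℕ} (hr : r < n) :
    greedyDigits n θ ω (n * i + r) = cfDigit (greedyPick n θ ω i) r := by
  rw [greedyDigits_eq_prefix (i := i + 1) (by linarith [mul_add n i 1]), greedyPrefix,
    if_neg (by omega), contDen_greedyPrefix, Nat.add_sub_cancel_left, greedyPick]

theorem contDen_greedyDigits_block (i : ℕ) :
    contDen (fun j => greedyDigits n θ ω (n * i + j)) n = qDen n (greedyPick n θ ω i) :=
  contDen_congr fun _ hr => greedyDigits_block i hr

theorem measurable_greedyPrefix (i j : ℕ) : Measurable fun ω => greedyPrefix n θ ω i j := by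
  induction i generalizing j with
  | zero => exact measurable_const
  | succ i ih =>
    simp only [greedyPrefix]
    split_ifs with h
    · exact ih j
    · refine (measurable_cfDigit _).comp (Measurable.ite ?_ ?_ ?_)
      · exact measurableSet_lt (measurable_from_top.comp (measurable_contDen ih (n * i)))
          measurable_const
      · exact measurable_fst.comp (measurable_pi_apply i)
      · exact measurable_snd.comp (measurable_pi_apply i)

theorem measurable_greedyDigits (j : ℕ) : Measurable fun ω => greedyDigits n θ ω j :=
  measurable_greedyPrefix _ _

end Greedy

/-- The first `n` digits of points of `A` form blocks with denominator at least `θ`, those of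
points of `B` form blocks with denominator at most `θ / 2`, and all these digits are at most
`M`. -/
structure IsBlockPair (n : ℕ) (θ : ℝ) (M : ℕ) (A B : Set ℝ) : Prop where
  pos : 0 < n
  one_lt : 1 < θ
  left_irrational : ∀ x ∈ A, x ∈ Ioo (0 : ℝ) 1 ∧ Irrational x
  right_irrational : ∀ x ∈ B, x ∈ Ioo (0 : ℝ) 1 ∧ Irrational x
  left_digit_le : ∀ x ∈ A, ∀ i < n, cfDigit x i ≤ M
  right_digit_le : ∀ x ∈ B, ∀ i < n, cfDigit x i ≤ M
  le_qDen : ∀ x ∈ A, θ ≤ qDen n x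
  qDen_le : ∀ x ∈ B, 2 * (qDen n x : ℝ) ≤ θ

/-- The multiplicative error of the greedy concatenation. -/
noncomputable def blockConst (n : ℕ) (θ : ℝ) (M : ℕ) : ℝ := max (2 * ((M : ℝ) + 1) ^ n) θ

namespace IsBlockPair

variable {n : ℕ} {θ : ℝ} {M : ℕ} {A B : Set ℝ} {ω : ℕ → ℝ × ℝ}

theorem one_le_blockConst (h : IsBlockPair n θ M A B) : 1 ≤ blockConst n θ M :=
  h.one_lt.le.trans (le_max_right _ _)

theorem greedyPick_mem (hω : ∀ i, ω i ∈ A ×ˢ B) (i : ℕ) :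
    greedyPick n θ ω i ∈ A ∪ B := by
  unfold greedyPick
  split_ifs
  · exact Or.inl (hω i).1
  · exact Or.inr (hω i).2

theorem irrational (h : IsBlockPair n θ M A B) {x : ℝ} (hx : x ∈ A ∪ B) :
    x ∈ Ioo (0 : ℝ) 1 ∧ Irrational x :=
  hx.elim (h.left_irrational x) (h.right_irrational x)

theorem digit_le (h : IsBlockPair n θ M A B) {x : ℝ} (hx : x ∈ A ∪ B) :
    ∀ i < n, cfDigit x i ≤ M :=
  hx.elim (h.left_digit_le x) (h.right_digit_le x)

theorem greedyDigits_mem (h : IsBlockPair n θ M A B) (hω : ∀ i, ω i ∈ A ×ˢ B) (j : ℕ) :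
    1 ≤ greedyDigits n θ ω j ∧ greedyDigits n θ ω j ≤ M := by
  rw [← Nat.div_add_mod j n, greedyDigits_block _ (Nat.mod_lt j h.pos)]
  have hx := greedyPick_mem (n := n) (θ := θ) hω (j / n)
  exact ⟨(isCFOrbit_of_irrational (h.irrational hx).1 (h.irrational hx).2).one_le_digit _,
    h.digit_le hx _ (Nat.mod_lt j h.pos)⟩

theorem two_mul_qDen_le (h : IsBlockPair n θ M A B) {x : ℝ} (hx : x ∈ A ∪ B) :
    2 * (qDen n x : ℝ) ≤ blockConst n θ M := by
  refine le_trans ?_ (le_max_left _ _)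
  have := contDen_le_pow (h.digit_le hx)
  have : (qDen n x : ℝ) ≤ ((M : ℝ) + 1) ^ n := by exact_mod_cast this
  linarith

theorem contDen_greedyDigits_pos (h : IsBlockPair n θ M A B) (hω : ∀ i, ω i ∈ A ×ˢ B) (j : ℕ) :
    (0 : ℝ) < contDen (greedyDigits n θ ω) j := by
  exact_mod_cast contDen_pos (fun j => (h.greedyDigits_mem hω j).1) j

theorem contDen_block_le (h : IsBlockPair n θ M A B) (hω : ∀ i, ω i ∈ A ×ˢ B) (i : ℕ) :
    (contDen (greedyDigits n θ ω) (n * (i + 1)) : ℝ)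
      ≤ contDen (greedyDigits n θ ω) (n * i) * (2 * qDen n (greedyPick n θ ω i)) := by
  have := contDen_add_le (fun j => (h.greedyDigits_mem hω j).1) (n * i) n
  rw [contDen_greedyDigits_block] at this
  have : (contDen (greedyDigits n θ ω) (n * (i + 1)) : ℝ) ≤
    2 * (contDen (greedyDigits n θ ω) (n * i) * qDen n (greedyPick n θ ω i)) := by
    exact_mod_cast this
  linarith

theorem le_contDen_block (i : ℕ) :
    (contDen (greedyDigits n θ ω) (n * i) : ℝ) * qDen n (greedyPick n θ ω i)
      ≤ contDen (greedyDigits n θ ω) (n * (i + 1)) := by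
  have := contDen_add_ge (d := greedyDigits n θ ω) (n * i) n
  rw [contDen_greedyDigits_block] at this
  exact_mod_cast this

theorem contDen_step_le (h : IsBlockPair n θ M A B) (hω : ∀ i, ω i ∈ A ×ˢ B) (i : ℕ) :
    (contDen (greedyDigits n θ ω) (n * (i + 1)) : ℝ)
      ≤ blockConst n θ M * contDen (greedyDigits n θ ω) (n * i) := by
  refine (h.contDen_block_le hω i).trans ?_
  rw [mul_comm]
  gcongr
  exact h.two_mul_qDen_le (greedyPick_mem hω i)

theorem contDen_le_mul_pow (h : IsBlockPair n θ M A B) (hω : ∀ i, ω i ∈ A ×ˢ B) (i : ℕ) :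
    (contDen (greedyDigits n θ ω) (n * i) : ℝ) ≤ blockConst n θ M * θ ^ i := by
  have hL := h.one_le_blockConst
  have hθ := h.one_lt
  induction i with
  | zero => simpa [contDen] using hL
  | succ i ih =>
    rcases lt_or_ge (contDen (greedyDigits n θ ω) (n * i) : ℝ) (θ ^ i) with hlt | hge
    · refine (h.contDen_step_le hω i).trans ?_
      gcongr
      exact hlt.le.trans (pow_le_pow_right₀ hθ.le (Nat.le_succ i))
    · have hp : greedyPick n θ ω i ∈ B := by
        rw [greedyPick, if_neg (not_lt.2 hge)]
        exact (hω i).2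
      refine (h.contDen_block_le hω i).trans ?_
      exact (mul_le_mul ih (h.qDen_le _ hp) (by positivity) (by positivity)).trans_eq (by ring)

theorem pow_le_mul_contDen (h : IsBlockPair n θ M A B) (hω : ∀ i, ω i ∈ A ×ˢ B) (i : ℕ) :
    θ ^ i ≤ blockConst n θ M * contDen (greedyDigits n θ ω) (n * i) := by
  have hL := h.one_le_blockConst
  have hθ := h.one_lt
  induction i with
  | zero => simpa [contDen] using hL
  | succ i ih =>
    rcases lt_or_ge (contDen (greedyDigits n θ ω) (n * i) : ℝ) (θ ^ i) with hlt | hge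
    · have hp : greedyPick n θ ω i ∈ A := by
        rw [greedyPick, if_pos hlt]
        exact (hω i).1
      calc θ ^ (i + 1) = θ ^ i * θ := pow_succ _ _
        _ ≤ blockConst n θ M * contDen (greedyDigits n θ ω) (n * i)
            * qDen n (greedyPick n θ ω i) := by
          gcongr
          exact h.le_qDen _ hp
        _ ≤ _ := by
          rw [mul_assoc]
          gcongr
          exact le_contDen_block i
    · have hmono : (contDen (greedyDigits n θ ω) (n * i) : ℝ)
          ≤ contDen (greedyDigits n θ ω) (n * (i + 1)) := by
        exact_mod_cast contDen_monotone (fun j => (h.greedyDigits_mem hω j).1) (by gcongr; simp)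
      calc θ ^ (i + 1) = θ * θ ^ i := pow_succ' _ _
        _ ≤ blockConst n θ M * contDen (greedyDigits n θ ω) (n * (i + 1)) := by
          gcongr
          · exact le_max_right _ _
          · exact hge.trans hmono

theorem contDen_le_two_pow_mul_prod (h : IsBlockPair n θ M A B) (hω : ∀ i, ω i ∈ A ×ˢ B) (m : ℕ) :
    (contDen (greedyDigits n θ ω) (n * m) : ℝ)
      ≤ 2 ^ m * ∏ i ∈ Finset.range m, (qDen n (greedyPick n θ ω i) : ℝ) := by
  induction m with
  | zero => simp [contDen]
  | succ m ih =>
    rw [Finset.prod_range_succ, pow_succ]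
    refine (h.contDen_block_le hω m).trans ?_
    calc _ ≤ (2 ^ m * ∏ i ∈ Finset.range m, (qDen n (greedyPick n θ ω i) : ℝ))
            * (2 * qDen n (greedyPick n θ ω m)) := by gcongr
      _ = _ := by ring

theorem abs_log_contDen_sub_le {α : ℝ} (hα : 0 < α)
    (h : IsBlockPair n (Real.exp (n * α / 2)) M A B) (hω : ∀ i, ω i ∈ A ×ˢ B) (N : ℕ) :
    |Real.log (contDen (greedyDigits n (Real.exp (n * α / 2)) ω) N) - N * α / 2|
      ≤ Real.log (blockConst n (Real.exp (n * α / 2)) M) + n * α / 2 := by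
  set θ := Real.exp (n * α / 2) with hθ
  set d := greedyDigits n θ ω
  have hL : 0 < blockConst n θ M := zero_lt_one.trans_le h.one_le_blockConst
  have hmono := contDen_monotone fun j => (h.greedyDigits_mem hω j).1
  have hlogpow : ∀ i : ℕ, Real.log (θ ^ i) = (n * i : ℕ) * α / 2 := fun i => by
    rw [Real.log_pow, hθ, Real.log_exp]
    push_cast
    ring
  have hdiv := Nat.div_add_mod N n
  have hmod := Nat.mod_lt N h.pos
  set i := N / n
  have h1 : ((n * i : ℕ) : ℝ) ≤ N := by exact_mod_cast (by omega : n * i ≤ N)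
  have h2 : (N : ℝ) ≤ (n * i : ℕ) + n := by exact_mod_cast (by omega : N ≤ n * i + n)
  have hθ0 : 0 < θ := Real.exp_pos _
  have hup : Real.log (contDen d N) ≤ Real.log (blockConst n θ M) + (n * (i + 1) : ℕ) * α / 2 := by
    rw [← hlogpow, ← Real.log_mul hL.ne' (by positivity)]
    refine Real.log_le_log (h.contDen_greedyDigits_pos hω N) ?_
    refine le_trans ?_ (h.contDen_le_mul_pow hω (i + 1))
    exact_mod_cast hmono (by rw [mul_add]; omega)
  have hlow : (n * i : ℕ) * α / 2 ≤ Real.log (blockConst n θ M) + Real.log (contDen d N) := by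
    rw [← hlogpow, ← Real.log_mul hL.ne' (h.contDen_greedyDigits_pos hω N).ne']
    refine Real.log_le_log (by positivity) ?_
    refine (h.pow_le_mul_contDen hω i).trans ?_
    gcongr
    exact hmono (by omega)
  rw [mul_add, mul_one] at hup
  push_cast at *
  rw [abs_le]
  constructor <;> nlinarith

theorem cfValue_mem_levelSet {α : ℝ} (hα : 0 < α)
    (h : IsBlockPair n (Real.exp (n * α / 2)) M A B) (hω : ∀ i, ω i ∈ A ×ˢ B)
    (hirr : Irrational (cfValue (greedyDigits n (Real.exp (n * α / 2)) ω))) :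
    cfValue (greedyDigits n (Real.exp (n * α / 2)) ω) ∈ levelSet (α : EReal) := by
  set d := greedyDigits n (Real.exp (n * α / 2)) ω with hd
  have ho := isCFOrbit_cfValue fun j => (h.greedyDigits_mem hω j).1
  have h0 : cfValue d = (fun i => cfValue fun j => d (i + j)) 0 := by simp
  have hq : ∀ N, qDen N (cfValue d) = contDen d N := fun N =>
    contDen_congr fun i _ => by rw [h0]; exact ho.cfDigit_eq i
  have hlim : Tendsto (fun N : ℕ => 2 / (N : ℝ) * Real.log (qDen N (cfValue d))) atTop (𝓝 α) := by
    simp only [hq]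
    set C := Real.log (blockConst n (Real.exp (n * α / 2)) M) + n * α / 2
    rw [tendsto_iff_dist_tendsto_zero]
    refine squeeze_zero' (Eventually.of_forall fun _ => dist_nonneg) ?_
      (tendsto_const_div_atTop_nhds_zero_nat (2 * C))
    filter_upwards [eventually_gt_atTop 0] with N hN
    have hN' : (0 : ℝ) < N := by exact_mod_cast hN
    have hb : |Real.log (contDen d N) - N * α / 2| ≤ C := h.abs_log_contDen_sub_le hα hω N
    rw [Real.dist_eq]
    have : 2 / (N : ℝ) * Real.log (contDen d N) - α
        = 2 / N * (Real.log (contDen d N) - N * α / 2) := by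
      field_simp
    rw [this, abs_mul, abs_of_pos (by positivity), div_mul_eq_mul_div]
    gcongr
  have hlim' : Tendsto (fun N : ℕ => ((2 / (N : ℝ) * Real.log (qDen N (cfValue d)) : ℝ) : EReal))
      atTop (𝓝 (α : EReal)) := (continuous_coe_real_ereal.tendsto α).comp hlim
  refine ⟨?_, hirr, hlim'.liminf_eq, hlim'.limsup_eq⟩
  rw [h0]
  exact (ho 0).1

end IsBlockPair

/-- The law of a sequence of independent pairs, each uniformly distributed in `A ×ˢ B`. -/
noncomputable def blockMeasure (A B : Set ℝ) : Measure (ℕ → ℝ × ℝ) :=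
  Measure.infinitePi fun _ =>
    (ProbabilityTheory.cond volume A).prod (ProbabilityTheory.cond volume B)

section BlockMeasure

open scoped ENNReal

variable {A B : Set ℝ}

theorem cond_cylinder_le {n : ℕ} {Z : ℝ} (hZ : 0 < Z) (hA : MeasurableSet A)
    (hirr : ∀ x ∈ A, x ∈ Ioo (0 : ℝ) 1 ∧ Irrational x) (hAZ : ENNReal.ofReal Z ≤ volume A)
    (y : ℝ) (hy : 0 < qDen n y) :
    ProbabilityTheory.cond volume A {x | ∀ i < n, cfDigit x i = cfDigit y i}
      ≤ ENNReal.ofReal (1 / (Z * (qDen n y : ℝ) ^ 2)) := by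
  have hq : (0 : ℝ) < qDen n y := by exact_mod_cast hy
  rw [ProbabilityTheory.cond_apply hA]
  calc _ ≤ (ENNReal.ofReal Z)⁻¹ * ENNReal.ofReal (1 / (qDen n y : ℝ) ^ 2) := by
        gcongr
        exact volume_cylinder_le hirr
    _ = _ := by
        rw [← ENNReal.ofReal_inv_of_pos hZ, ← ENNReal.ofReal_mul (by positivity)]
        congr 1
        field_simp

theorem measurableSet_cylinder (n : ℕ) (y : ℝ) :
    MeasurableSet {x | ∀ i < n, cfDigit x i = cfDigit y i} := by
  simp only [ofPred_forall]
  exact MeasurableSet.iInter fun i => MeasurableSet.iInter fun _ =>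
    measurable_cfDigit i (measurableSet_singleton _)

theorem blockMeasure_ae_mem (hA : MeasurableSet A) (hB : MeasurableSet B)
    (hA0 : volume A ≠ 0) (hA1 : volume A ≠ ∞) (hB0 : volume B ≠ 0) (hB1 : volume B ≠ ∞) :
    ∀ᵐ ω ∂(blockMeasure A B), ∀ i, ω i ∈ A ×ˢ B := by
  have := ProbabilityTheory.cond_isProbabilityMeasure_of_finite (μ := volume) (s := A) hA0 hA1
  have := ProbabilityTheory.cond_isProbabilityMeasure_of_finite (μ := volume) (s := B) hB0 hB1
  rw [ae_all_iff]
  intro i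
  have h1 : ∀ᵐ p ∂((ProbabilityTheory.cond volume A).prod (ProbabilityTheory.cond volume B)),
      p ∈ A ×ˢ B := by
    change A ×ˢ B ∈ ae _
    rw [mem_ae_iff_prob_eq_one (hA.prod hB), Measure.prod_prod,
      (prob_compl_eq_zero_iff hA).1 (ProbabilityTheory.ae_cond_mem hA),
      (prob_compl_eq_zero_iff hB).1 (ProbabilityTheory.ae_cond_mem hB), one_mul]
  have h2 := (measurePreserving_eval_infinitePi (fun _ : ℕ =>
    (ProbabilityTheory.cond volume A).prod (ProbabilityTheory.cond volume B)) i)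
  exact h2.quasiMeasurePreserving.ae h1

theorem IsBlockPair.blockMeasure_cylinder_le {n : ℕ} {θ : ℝ} {M : ℕ}
    (h : IsBlockPair n θ M A B) {Z κ : ℝ} (hZ : 0 < Z) (hκ : θ ^ κ = 4 / Z) (hκ0 : 0 ≤ κ)
    (hA : MeasurableSet A) (hB : MeasurableSet B)
    (hAZ : ENNReal.ofReal Z ≤ volume A) (hBZ : ENNReal.ofReal Z ≤ volume B)
    (hA1 : volume A ≠ ∞) (hB1 : volume B ≠ ∞) {ω₀ : ℕ → ℝ × ℝ} (hω₀ : ∀ i, ω₀ i ∈ A ×ˢ B)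
    (m : ℕ) :
    blockMeasure A B
        {ω | ∀ j < n * m, greedyDigits n θ ω j = greedyDigits n θ ω₀ j}
      ≤ ENNReal.ofReal (blockConst n θ M ^ κ
          * (contDen (greedyDigits n θ ω₀) (n * m) : ℝ) ^ (κ - 2)) := by
  have hZ0 : ENNReal.ofReal Z ≠ 0 := by simpa using hZ
  have := ProbabilityTheory.cond_isProbabilityMeasure_of_finite (μ := volume) (s := A)
    (fun h => hZ0 (le_zero_iff.1 (hAZ.trans_eq h))) hA1
  have := ProbabilityTheory.cond_isProbabilityMeasure_of_finite (μ := volume) (s := B)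
    (fun h => hZ0 (le_zero_iff.1 (hBZ.trans_eq h))) hB1
  set d := greedyDigits n θ ω₀ with hd
  let C : ℕ → Set ℝ := fun i => {x | ∀ r < n, cfDigit x r = cfDigit (greedyPick n θ ω₀ i) r}
  let S : ℕ → Set (ℝ × ℝ) := fun i =>
    if (contDen d (n * i) : ℝ) < θ ^ i then C i ×ˢ univ else univ ×ˢ C i
  have hCm : ∀ i, MeasurableSet (C i) := fun i => measurableSet_cylinder n _
  have hSm : ∀ i, MeasurableSet (S i) := fun i => by
    simp only [S]
    split_ifs
    · exact (hCm i).prod .univ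
    · exact MeasurableSet.univ.prod (hCm i)
  have hq : ∀ i, 0 < qDen n (greedyPick n θ ω₀ i) := fun i => by
    have hx := h.irrational (IsBlockPair.greedyPick_mem (n := n) (θ := θ) hω₀ i)
    exact contDen_pos (isCFOrbit_of_irrational hx.1 hx.2).one_le_digit n
  have hSle : ∀ i, ((ProbabilityTheory.cond volume A).prod (ProbabilityTheory.cond volume B)) (S i)
      ≤ ENNReal.ofReal (1 / (Z * (qDen n (greedyPick n θ ω₀ i) : ℝ) ^ 2)) := fun i => by
    simp only [S]
    split_ifs
    · rw [Measure.prod_prod, measure_univ, mul_one]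
      exact cond_cylinder_le hZ hA h.left_irrational hAZ _ (hq i)
    · rw [Measure.prod_prod, measure_univ, one_mul]
      exact cond_cylinder_le hZ hB h.right_irrational hBZ _ (hq i)
  have hsub : {ω | ∀ j < n * m, greedyDigits n θ ω j = d j}
      ⊆ Set.pi (Finset.range m : Set ℕ) S := by
    intro ω hω i hi
    have hi : i < m := by simpa using hi
    have hle : n * i + n ≤ n * m := by nlinarith
    have hden : contDen (greedyDigits n θ ω) (n * i) = contDen d (n * i) :=
      contDen_congr fun j hj => hω j (by omega)
    have hpick : greedyPick n θ ω i ∈ C i := fun r hr => by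
      rw [← greedyDigits_block i hr, ← greedyDigits_block i hr]
      exact hω _ (by omega)
    rw [greedyPick, hden] at hpick
    simp only [S]
    split_ifs with hc
    · rw [if_pos hc] at hpick
      exact ⟨hpick, trivial⟩
    · rw [if_neg hc] at hpick
      exact ⟨trivial, hpick⟩
  refine (measure_mono hsub).trans ?_
  rw [blockMeasure, Measure.infinitePi_pi _ fun i _ => hSm i]
  refine (Finset.prod_le_prod' fun i _ => hSle i).trans ?_
  rw [← ENNReal.ofReal_prod_of_nonneg fun i _ => by positivity]
  refine ENNReal.ofReal_le_ofReal ?_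
  have hθ := zero_lt_one.trans h.one_lt
  have hL := zero_lt_one.trans_le h.one_le_blockConst
  have hQ := h.contDen_greedyDigits_pos hω₀ (n * m)
  have hprod := h.contDen_le_two_pow_mul_prod hω₀ m
  have hpow := h.pow_le_mul_contDen hω₀ m
  rw [← hd] at hQ hprod hpow
  set Q : ℝ := ((contDen d (n * m) : ℕ) : ℝ)
  set R : ℝ := ∏ i ∈ Finset.range m, (qDen n (greedyPick n θ ω₀ i) : ℝ)
  have hR : 0 < R := Finset.prod_pos fun i _ => by exact_mod_cast hq i
  have e1 : ∏ i ∈ Finset.range m, 1 / (Z * (qDen n (greedyPick n θ ω₀ i) : ℝ) ^ 2)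
      = 1 / (Z ^ m * R ^ 2) := by
    rw [Finset.prod_div_distrib, Finset.prod_mul_distrib, Finset.prod_pow]
    simp [R]
  have e2 : 1 / (Z ^ m * R ^ 2) ≤ (4 / Z) ^ m / Q ^ 2 := by
    have : Q ^ 2 ≤ 4 ^ m * R ^ 2 := by
      calc Q ^ 2 ≤ (2 ^ m * R) ^ 2 := by gcongr
        _ = 4 ^ m * R ^ 2 := by
          rw [mul_pow, ← pow_mul, mul_comm m, pow_mul]; norm_num
    rw [div_pow, div_div, div_le_div_iff₀ (by positivity) (by positivity), one_mul]
    nlinarith [pow_pos hZ m]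
  have e3 : (4 / Z) ^ m ≤ (blockConst n θ M * Q) ^ κ := by
    rw [← hκ, ← Real.rpow_natCast, ← Real.rpow_mul hθ.le, mul_comm κ, Real.rpow_mul hθ.le,
      Real.rpow_natCast]
    gcongr
  calc _ = 1 / (Z ^ m * R ^ 2) := e1
    _ ≤ (4 / Z) ^ m / Q ^ 2 := e2
    _ ≤ (blockConst n θ M * Q) ^ κ / Q ^ 2 := by gcongr
    _ = _ := by
      rw [Real.mul_rpow hL.le hQ.le, Real.rpow_sub hQ, mul_div_assoc]
      norm_num

end BlockMeasure

section Dimension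

open scoped ENNReal

variable {A B : Set ℝ} {n M : ℕ} {θ Z κ : ℝ}

theorem IsBlockPair.tendsto_contDen (h : IsBlockPair n θ M A B) {ω : ℕ → ℝ × ℝ}
    (hω : ∀ i, ω i ∈ A ×ˢ B) :
    Tendsto (fun m => (contDen (greedyDigits n θ ω) (n * m) : ℝ)) atTop atTop := by
  have hL := zero_lt_one.trans_le h.one_le_blockConst
  refine tendsto_atTop_mono (fun m => ?_)
    ((tendsto_pow_atTop_atTop_of_one_lt h.one_lt).atTop_div_const hL)
  rw [div_le_iff₀' hL]
  exact h.pow_le_mul_contDen hω m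

theorem IsBlockPair.blockMeasure_preimage_le
    (h : IsBlockPair n θ M A B) (hZ : 0 < Z) (hκ : θ ^ κ = 4 / Z) (hκ0 : 0 ≤ κ) (hκ2 : κ < 2)
    (hA : MeasurableSet A) (hB : MeasurableSet B)
    (hAZ : ENNReal.ofReal Z ≤ volume A) (hBZ : ENNReal.ofReal Z ≤ volume B)
    (hA1 : volume A ≠ ∞) (hB1 : volume B ≠ ∞) (S : Set ℝ) :
    blockMeasure A B
        ((fun ω => cfValue (greedyDigits n θ ω)) ⁻¹' S ∩ {ω | ∀ i, ω i ∈ A ×ˢ B})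
      ≤ ENNReal.ofReal (blockConst n θ M ^ κ
          * (4 * ((M : ℝ) + 1) ^ 3 * blockConst n θ M ^ 2) ^ (1 - κ / 2))
          * Metric.ediam S ^ (1 - κ / 2) := by
  set E := (fun ω => cfValue (greedyDigits n θ ω)) ⁻¹' S ∩ {ω | ∀ i, ω i ∈ A ×ˢ B} with hE
  set L := blockConst n θ M
  have hL : 0 < L := zero_lt_one.trans_le h.one_le_blockConst
  rcases E.eq_empty_or_nonempty with h0 | ⟨ω₀, hω₀S, hω₀⟩
  · rw [h0, measure_empty]
    exact zero_le
  have hω₀ : ∀ i, ω₀ i ∈ A ×ˢ B := hω₀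
  have hcyl := h.blockMeasure_cylinder_le hZ hκ hκ0 hA hB hAZ hBZ hA1 hB1 hω₀
  by_cases hall : ∀ m, ∀ ω ∈ E, ∀ j < n * m, greedyDigits n θ ω j = greedyDigits n θ ω₀ j
  · have hle : ∀ m, blockMeasure A B E ≤ ENNReal.ofReal (L ^ κ
        * (contDen (greedyDigits n θ ω₀) (n * m) : ℝ) ^ (κ - 2)) := fun m =>
      (measure_mono (hall m)).trans (hcyl m)
    have hlim : Tendsto (fun m => ENNReal.ofReal (L ^ κ
        * (contDen (greedyDigits n θ ω₀) (n * m) : ℝ) ^ (κ - 2))) atTop (𝓝 0) := by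
      rw [← ENNReal.ofReal_zero]
      refine ENNReal.tendsto_ofReal ?_
      have h1 := (tendsto_rpow_neg_atTop (by linarith : 0 < 2 - κ)).comp (h.tendsto_contDen hω₀)
      have h2 := h1.const_mul (L ^ κ)
      simpa [Function.comp_def] using h2
    have := ge_of_tendsto' hlim hle
    exact this.trans zero_le
  · have hex : ∃ m, ¬ ∀ ω ∈ E, ∀ j < n * m, greedyDigits n θ ω j = greedyDigits n θ ω₀ j := by
      simpa only [not_forall] using hall
    classical
    obtain ⟨m, hm, hmin⟩ : ∃ m,
        (¬ ∀ ω ∈ E, ∀ j < n * m, greedyDigits n θ ω j = greedyDigits n θ ω₀ j) ∧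
        ∀ k < m, ∀ ω ∈ E, ∀ j < n * k, greedyDigits n θ ω j = greedyDigits n θ ω₀ j :=
      ⟨Nat.find hex, Nat.find_spec hex, fun k hk => not_not.1 (Nat.find_min hex hk)⟩
    obtain ⟨m, rfl⟩ : ∃ m', m = m' + 1 := by
      refine Nat.exists_eq_succ_of_ne_zero ?_
      rintro rfl
      simp at hm
    push Not at hm
    obtain ⟨ω, hωE, hω⟩ := hm
    have hωG : ∀ i, ω i ∈ A ×ˢ B := hωE.2
    set d := greedyDigits n θ ω₀
    set e := greedyDigits n θ ω
    obtain ⟨k, hk, hkne, hkmin⟩ : ∃ k < n * (m + 1), e k ≠ d k ∧ ∀ j < k, e j = d j := by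
      have hex' : ∃ k, e k ≠ d k := hω.imp fun _ h => h.2
      obtain ⟨j, hj, hjne⟩ := hω
      exact ⟨Nat.find hex', (Nat.find_min' hex' hjne).trans_lt hj, Nat.find_spec hex',
        fun i hi => not_not.1 (Nat.find_min hex' hi)⟩
    have hQ := h.contDen_greedyDigits_pos hω₀ (n * m)
    have hQk := h.contDen_greedyDigits_pos hω₀ k
    have hQle : (contDen d k : ℝ) ≤ L * contDen d (n * m) :=
      le_trans (by
        exact_mod_cast contDen_monotone (fun j => (h.greedyDigits_mem hω₀ j).1) hk.le)
        (h.contDen_step_le hω₀ m)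
    have hdist : 1 / (4 * ((M : ℝ) + 1) ^ 3 * (contDen d k : ℝ) ^ 2)
        ≤ |cfValue d - cfValue e| := by
      have := (isCFOrbit_cfValue fun j => (h.greedyDigits_mem hω₀ j).1).le_abs_sub
        (isCFOrbit_cfValue fun j => (h.greedyDigits_mem hωG j).1)
        (fun j => (h.greedyDigits_mem hω₀ j).2) (fun j => (h.greedyDigits_mem hωG j).2)
        (fun j hj => (hkmin j hj).symm) hkne.symm
      simpa using this
    set δ := |cfValue d - cfValue e|
    set Q : ℝ := ((contDen d (n * m) : ℕ) : ℝ)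
    have hδ : 1 / Q ^ 2 ≤ 4 * ((M : ℝ) + 1) ^ 3 * L ^ 2 * δ := by
      have h1 : 1 / (4 * ((M : ℝ) + 1) ^ 3 * (L * Q) ^ 2) ≤ δ :=
        le_trans (by gcongr) hdist
      rw [div_le_iff₀ (by positivity)] at h1 ⊢
      calc (1 : ℝ) ≤ δ * (4 * ((M : ℝ) + 1) ^ 3 * (L * Q) ^ 2) := h1
        _ = _ := by ring
    have hδS : ENNReal.ofReal δ ≤ Metric.ediam S := by
      have h1 : cfValue d ∈ S := hω₀S
      have h2 : cfValue e ∈ S := hωE.1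
      have := Metric.edist_le_ediam_of_mem h1 h2
      rwa [edist_dist, Real.dist_eq] at this
    have hδ0 : 0 ≤ δ := abs_nonneg _
    have hs : 0 < 1 - κ / 2 := by linarith
    calc blockMeasure A B E ≤ ENNReal.ofReal (L ^ κ * Q ^ (κ - 2)) :=
          (measure_mono (hmin m (Nat.lt_succ_self m))).trans (hcyl m)
      _ ≤ ENNReal.ofReal (L ^ κ * (4 * ((M : ℝ) + 1) ^ 3 * L ^ 2) ^ (1 - κ / 2)
            * δ ^ (1 - κ / 2)) := by
          refine ENNReal.ofReal_le_ofReal ?_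
          rw [mul_assoc, ← Real.mul_rpow (by positivity) hδ0]
          gcongr
          calc Q ^ (κ - 2) = (1 / Q ^ 2) ^ (1 - κ / 2) := by
                rw [one_div, ← Real.rpow_natCast, ← Real.rpow_neg hQ.le, ← Real.rpow_mul hQ.le]
                congr 1
                push_cast
                ring
            _ ≤ _ := by gcongr
      _ ≤ _ := by
          rw [ENNReal.ofReal_mul (by positivity), ← ENNReal.ofReal_rpow_of_nonneg hδ0 hs.le]
          gcongr

theorem IsBlockPair.le_dimH_levelSet {α : ℝ} (hα : 0 < α)
    (h : IsBlockPair n (Real.exp (n * α / 2)) M A B) (hZ : 0 < Z)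
    (hκ : Real.exp (n * α / 2) ^ κ = 4 / Z) (hκ0 : 0 ≤ κ) (hκ2 : κ < 2)
    (hA : MeasurableSet A) (hB : MeasurableSet B)
    (hAZ : ENNReal.ofReal Z ≤ volume A) (hBZ : ENNReal.ofReal Z ≤ volume B)
    (hA1 : volume A ≠ ∞) (hB1 : volume B ≠ ∞) :
    ENNReal.ofReal (1 - κ / 2) ≤ dimH (levelSet (α : EReal)) := by
  set θ := Real.exp (n * α / 2)
  have hZ0 : ENNReal.ofReal Z ≠ 0 := by simpa using hZ
  have hA0 : volume A ≠ 0 := fun h => hZ0 (le_zero_iff.1 (hAZ.trans_eq h))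
  have hB0 : volume B ≠ 0 := fun h => hZ0 (le_zero_iff.1 (hBZ.trans_eq h))
  have := ProbabilityTheory.cond_isProbabilityMeasure_of_finite (μ := volume) (s := A) hA0 hA1
  have := ProbabilityTheory.cond_isProbabilityMeasure_of_finite (μ := volume) (s := B) hB0 hB1
  have hP : IsProbabilityMeasure (blockMeasure A B) := by
    unfold blockMeasure
    infer_instance
  have hG := blockMeasure_ae_mem hA hB hA0 hA1 hB0 hB1
  set F : (ℕ → ℝ × ℝ) → ℝ := fun ω => cfValue (greedyDigits n θ ω)
  have hF : Measurable F :=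
    measurable_cfValue.comp (measurable_pi_lambda _ fun j => measurable_greedyDigits j)
  set K := blockConst n θ M ^ κ
    * (4 * ((M : ℝ) + 1) ^ 3 * blockConst n θ M ^ 2) ^ (1 - κ / 2)
  have hK : 0 < K := by
    have : 0 < blockConst n θ M := zero_lt_one.trans_le h.one_le_blockConst
    positivity
  have hK0 : ENNReal.ofReal K ≠ 0 := by simpa using hK
  have hs : 0 < 1 - κ / 2 := by linarith
  set T : Set ℝ := levelSet (α : EReal) ∪ range ((↑) : ℚ → ℝ)
  have hle : (ENNReal.ofReal K)⁻¹ • (blockMeasure A B).map F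
      ≤ Measure.hausdorffMeasure (1 - κ / 2) := by
    refine Measure.le_hausdorffMeasure _ _ 1 one_pos fun S _ => ?_
    rw [← Metric.ediam_closure S]
    refine (measure_mono subset_closure).trans ?_
    rw [Measure.smul_apply, Measure.map_apply hF isClosed_closure.measurableSet, smul_eq_mul,
      ← measure_inter_conull hG]
    refine (mul_le_mul_right (h.blockMeasure_preimage_le hZ hκ hκ0 hκ2 hA hB hAZ hBZ hA1 hB1
      (closure S)) _).trans_eq ?_
    rw [← mul_assoc, ENNReal.inv_mul_cancel hK0 ENNReal.ofReal_ne_top, one_mul]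
  have hT : Measure.hausdorffMeasure (1 - κ / 2) T ≠ 0 := by
    have h1 : 1 ≤ blockMeasure A B (F ⁻¹' T) := by
      rw [← measure_univ (μ := blockMeasure A B)]
      refine measure_mono_ae ?_
      filter_upwards [hG] with ω hω _
      by_cases hirr : Irrational (F ω)
      · exact Or.inl (h.cfValue_mem_levelSet hα hω hirr)
      · exact Or.inr (not_not.1 hirr)
    have h2 : (ENNReal.ofReal K)⁻¹ ≤ Measure.hausdorffMeasure (1 - κ / 2) T := by
      refine le_trans ?_ (hle T)
      rw [Measure.smul_apply, smul_eq_mul]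
      exact le_mul_of_one_le_right' (h1.trans (Measure.le_map_apply hF.aemeasurable T))
    intro h0
    rw [h0, le_zero_iff, ENNReal.inv_eq_zero] at h2
    exact ENNReal.ofReal_ne_top h2
  have hdim : dimH T = dimH (levelSet (α : EReal)) := by
    rw [dimH_union, dimH_countable (countable_range _)]
    simp
  rw [← hdim]
  refine le_dimH_of_hausdorffMeasure_ne_zero ?_
  rwa [Real.coe_toNNReal _ hs.le]

end Dimension

section GaussMeasure

open scoped ENNReal

theorem gaussMap_inv_add {y : ℝ} (hy : y ∈ Ioo (0 : ℝ) 1) (k : ℕ) :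
    gaussMap (y + (k + 1))⁻¹ = y := by
  have : y + (k + 1) = y + ((k + 1 : ℕ) : ℝ) := by push_cast; rfl
  rw [gaussMap, one_div, inv_inv, this, Int.fract_add_natCast]
  exact Int.fract_eq_self.2 ⟨hy.1.le, hy.2⟩

theorem Ioo_ae_le_iUnion_image_inv_add :
    Ioo (0 : ℝ) 1 ≤ᵐ[volume] ⋃ k : ℕ, (fun y : ℝ => (y + (k + 1))⁻¹) '' Ioo (0 : ℝ) 1 := by
  filter_upwards [ae_irrational] with x hx hx01
  have ho := isCFOrbit_of_irrational hx01 hx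
  refine mem_iUnion.2 ⟨cfDigit x 0 - 1, gaussMap x, (ho 1).1, ?_⟩
  have h1 : ((cfDigit x 0 - 1 : ℕ) : ℝ) + 1 = cfDigit x 0 := by
    exact_mod_cast Nat.sub_add_cancel (ho.one_le_digit 0)
  have h2 : x * (cfDigit x 0 + gaussMap x) = 1 := (ho 0).2
  show (gaussMap x + (((cfDigit x 0 - 1 : ℕ) : ℝ) + 1))⁻¹ = x
  rw [h1, add_comm]
  exact inv_eq_of_mul_eq_one_left h2

/-- The Gauss measure is invariant under the Gauss map. -/
theorem lintegral_comp_gaussMap_le {φ : ℝ → ℝ≥0∞} (hφ : Measurable φ) :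
    ∫⁻ x in Ioo (0 : ℝ) 1, φ (gaussMap x) * ENNReal.ofReal (1 / (1 + x))
      ≤ ∫⁻ x in Ioo (0 : ℝ) 1, φ x * ENNReal.ofReal (1 / (1 + x)) := by
  have hder : ∀ k : ℕ, ∀ y ∈ Ioo (0 : ℝ) 1,
      HasDerivWithinAt (fun y : ℝ => (y + (k + 1))⁻¹) (-1 / (y + (k + 1)) ^ 2) (Ioo 0 1) y := by
    intro k y hy
    have h0 : y + (k + 1) ≠ 0 := by have := hy.1; positivity
    exact (((hasDerivAt_id y).add_const _).inv h0).hasDerivWithinAt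
  have hinj : ∀ k : ℕ, InjOn (fun y : ℝ => (y + (k + 1))⁻¹) (Ioo (0 : ℝ) 1) := by
    intro k y _ z _ hyz
    simpa using hyz
  calc _ ≤ ∫⁻ x in ⋃ k : ℕ, (fun y : ℝ => (y + (k + 1))⁻¹) '' Ioo (0 : ℝ) 1,
          φ (gaussMap x) * ENNReal.ofReal (1 / (1 + x)) :=
        lintegral_mono_set' Ioo_ae_le_iUnion_image_inv_add
    _ ≤ ∑' k : ℕ, ∫⁻ x in (fun y : ℝ => (y + (k + 1))⁻¹) '' Ioo (0 : ℝ) 1,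
          φ (gaussMap x) * ENNReal.ofReal (1 / (1 + x)) := lintegral_iUnion_le _ _
    _ = ∑' k : ℕ, ∫⁻ y in Ioo (0 : ℝ) 1,
          φ y * ENNReal.ofReal (1 / ((y + (k + 1)) * (y + (k + 1) + 1))) := by
        congr 1
        ext k
        rw [lintegral_image_eq_lintegral_abs_deriv_mul measurableSet_Ioo (hder k) (hinj k)]
        refine setLIntegral_congr_fun measurableSet_Ioo fun y hy => ?_
        have h0 : 0 < y + (k + 1) := by have := hy.1; positivity
        rw [gaussMap_inv_add hy, mul_left_comm, ← ENNReal.ofReal_mul (abs_nonneg _)]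
        congr 2
        rw [abs_div, abs_neg, abs_one, abs_of_pos (by positivity : 0 < (y + ((k : ℝ) + 1)) ^ 2)]
        field_simp
    _ = ∫⁻ y in Ioo (0 : ℝ) 1, ∑' k : ℕ,
          φ y * ENNReal.ofReal (1 / ((y + (k + 1)) * (y + (k + 1) + 1))) := by
        rw [lintegral_tsum fun k => by fun_prop]
    _ ≤ _ := by
        refine setLIntegral_mono_ae (by fun_prop) (Eventually.of_forall fun y hy => ?_)
        rw [ENNReal.tsum_mul_left]
        gcongr
        refine ENNReal.tsum_le_of_sum_range_le fun n => ?_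
        have hy0 := hy.1
        rw [← ENNReal.ofReal_sum_of_nonneg fun k _ => by positivity]
        refine ENNReal.ofReal_le_ofReal ?_
        have : ∀ n : ℕ, ∑ k ∈ Finset.range n, 1 / ((y + (k + 1)) * (y + (k + 1) + 1))
            = 1 / (1 + y) - 1 / (y + (n + 1)) := by
          intro n
          induction n with
          | zero => simp [add_comm]
          | succ n ih =>
            rw [Finset.sum_range_succ, ih]
            push_cast
            field_simp
            ring
        rw [this]
        have : 0 ≤ 1 / (y + ((n : ℝ) + 1)) := by positivity
        linarith

theorem lintegral_comp_iterate_gaussMap_le {φ : ℝ → ℝ≥0∞} (hφ : Measurable φ) (i : ℕ) :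
    ∫⁻ x in Ioo (0 : ℝ) 1, φ (gaussMap^[i] x) * ENNReal.ofReal (1 / (1 + x))
      ≤ ∫⁻ x in Ioo (0 : ℝ) 1, φ x * ENNReal.ofReal (1 / (1 + x)) := by
  induction i with
  | zero => rfl
  | succ i ih =>
    refine le_trans ?_ ih
    exact lintegral_comp_gaussMap_le (hφ.comp (measurable_gaussMap.iterate i))

theorem integral_pow_mul_neg_log (m : ℕ) :
    IntegrableOn (fun x : ℝ => x ^ m * -Real.log x) (Ioc 0 1) ∧
      ∫ x in (0 : ℝ)..1, x ^ m * -Real.log x = 1 / ((m : ℝ) + 1) ^ 2 := by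
  set G : ℝ → ℝ := fun x =>
    x ^ (m + 1) / ((m : ℝ) + 1) ^ 2 - x ^ m * (x * Real.log x) / ((m : ℝ) + 1) with hG
  have hcont : Continuous G :=
    ((continuous_pow _).div_const _).sub
      (((continuous_pow m).mul Real.continuous_mul_log).div_const _)
  have hder : ∀ x ∈ Ioo (0 : ℝ) 1, HasDerivAt G (x ^ m * -Real.log x) x := by
    intro x hx
    have hx0 : x ≠ 0 := hx.1.ne'
    have h1 := ((hasDerivAt_pow (m + 1) x).div_const (((m : ℝ) + 1) ^ 2)).sub
      (((hasDerivAt_pow (m + 1) x).mul (Real.hasDerivAt_log hx0)).div_const ((m : ℝ) + 1))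
    have h2 : HasDerivAt G _ x := h1.congr_of_eventuallyEq
      (Eventually.of_forall fun y => by simp only [hG, Pi.sub_apply, Pi.mul_apply]; ring)
    convert h2 using 1
    push_cast
    field_simp
    ring
  have hint : IntegrableOn (fun x : ℝ => x ^ m * -Real.log x) (Ioc 0 1) :=
    intervalIntegral.integrableOn_deriv_of_nonneg hcont.continuousOn hder fun x hx =>
      mul_nonneg (pow_nonneg hx.1.le _) (neg_nonneg.2 (Real.log_nonpos hx.1.le hx.2.le))
  refine ⟨hint, ?_⟩
  rw [intervalIntegral.integral_eq_sub_of_hasDerivAt_of_le zero_le_one hcont.continuousOn hder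
    ((intervalIntegrable_iff_integrableOn_Ioc_of_le zero_le_one).2 hint)]
  simp [hG]

theorem HasSum.congr_fun_eq {f g : ℕ → ℝ} {a : ℝ} (hg : HasSum g a) (h : ∀ k, f k = g k) :
    HasSum f a := by
  rwa [funext h]

theorem hasSum_one_div_odd_sq_sub_even_sq :
    HasSum (fun k : ℕ => 1 / (2 * (k : ℝ) + 1) ^ 2 - 1 / (2 * (k : ℝ) + 2) ^ 2)
      (Real.pi ^ 2 / 12) := by
  have h := hasSum_zeta_two
  have he : HasSum (fun k : ℕ => 1 / ((2 * k : ℕ) : ℝ) ^ 2) (Real.pi ^ 2 / 24) := by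
    rw [show Real.pi ^ 2 / 24 = 1 / 4 * (Real.pi ^ 2 / 6) by ring]
    refine HasSum.congr_fun_eq (h.mul_left (1 / 4)) fun k => ?_
    push_cast
    rw [mul_pow, one_div_mul_one_div]
    norm_num
  have hs : Summable (fun k : ℕ => 1 / ((2 * k + 1 : ℕ) : ℝ) ^ 2) :=
    h.summable.comp_injective (i := fun k : ℕ => 2 * k + 1)
      ((add_left_injective 1).comp (mul_right_injective₀ two_ne_zero))
  have ho : HasSum (fun k : ℕ => 1 / ((2 * k + 1 : ℕ) : ℝ) ^ 2) (Real.pi ^ 2 / 8) := by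
    have := (HasSum.even_add_odd (f := fun n : ℕ => 1 / (n : ℝ) ^ 2) he hs.hasSum).unique h
    have h3 := hs.hasSum
    rwa [show ∑' k : ℕ, 1 / ((2 * k + 1 : ℕ) : ℝ) ^ 2 = Real.pi ^ 2 / 8 by linarith] at h3
  have he' := (hasSum_nat_add_iff' (f := fun k : ℕ => 1 / ((2 * k : ℕ) : ℝ) ^ 2) 1).2 he
  have hd := ho.sub he'
  simp only [Finset.range_one, Finset.sum_singleton, mul_zero, Nat.cast_zero, ne_eq,
    OfNat.ofNat_ne_zero, not_false_eq_true, zero_pow, div_zero, sub_zero] at hd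
  rw [show Real.pi ^ 2 / 12 = Real.pi ^ 2 / 8 - Real.pi ^ 2 / 24 by ring]
  refine HasSum.congr_fun_eq hd fun k => ?_
  push_cast
  ring

theorem lintegral_neg_log_le :
    ∫⁻ x in Ioo (0 : ℝ) 1, ENNReal.ofReal (-Real.log x) * ENNReal.ofReal (1 / (1 + x))
      ≤ ENNReal.ofReal (Real.pi ^ 2 / 12) := by
  have hpt : ∀ x ∈ Ioo (0 : ℝ) 1,
      ENNReal.ofReal (-Real.log x) * ENNReal.ofReal (1 / (1 + x))
        = ∑' k : ℕ, ENNReal.ofReal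
          (x ^ (2 * k) * -Real.log x - x ^ (2 * k + 1) * -Real.log x) := by
    intro x hx
    have hl : 0 ≤ -Real.log x := neg_nonneg.2 (Real.log_nonpos hx.1.le hx.2.le)
    have hx2 : x ^ 2 < 1 := by nlinarith [hx.1, hx.2]
    have hs : HasSum (fun k : ℕ => x ^ (2 * k) * -Real.log x - x ^ (2 * k + 1) * -Real.log x)
        (-Real.log x * (1 / (1 + x))) := by
      have h1 : 1 + x ≠ 0 := by linarith [hx.1]
      have h2 : 1 - x ^ 2 ≠ 0 := by linarith
      rw [show -Real.log x * (1 / (1 + x)) = (1 - x) * -Real.log x * (1 - x ^ 2)⁻¹ by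
        field_simp
        ring]
      refine HasSum.congr_fun_eq ((hasSum_geometric_of_lt_one (sq_nonneg x) hx2).mul_left
        ((1 - x) * -Real.log x)) fun k => ?_
      rw [pow_succ, pow_mul]
      ring
    rw [← ENNReal.ofReal_mul hl, ← hs.tsum_eq, ENNReal.ofReal_tsum_of_nonneg _ hs.summable]
    intro k
    have : x ^ (2 * k + 1) ≤ x ^ (2 * k) :=
      pow_le_pow_of_le_one hx.1.le hx.2.le (Nat.le_succ _)
    nlinarith
  rw [setLIntegral_congr_fun measurableSet_Ioo hpt, lintegral_tsum fun k => by fun_prop]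
  have hterm : ∀ k : ℕ, ∫⁻ x in Ioo (0 : ℝ) 1, ENNReal.ofReal
      (x ^ (2 * k) * -Real.log x - x ^ (2 * k + 1) * -Real.log x)
      = ENNReal.ofReal (1 / (2 * (k : ℝ) + 1) ^ 2 - 1 / (2 * (k : ℝ) + 2) ^ 2) := by
    intro k
    obtain ⟨hi1, he1⟩ := integral_pow_mul_neg_log (2 * k)
    obtain ⟨hi2, he2⟩ := integral_pow_mul_neg_log (2 * k + 1)
    rw [intervalIntegral.integral_of_le zero_le_one] at he1 he2
    have hsub : IntegrableOn
        (fun x => x ^ (2 * k) * -Real.log x - x ^ (2 * k + 1) * -Real.log x) (Ioc 0 1) :=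
      hi1.sub hi2
    rw [restrict_Ioo_eq_restrict_Ioc, ← ofReal_integral_eq_lintegral_ofReal hsub,
      integral_sub hi1 hi2, he1, he2]
    · push_cast
      ring_nf
    · refine (ae_restrict_iff' measurableSet_Ioc).2 (Eventually.of_forall fun x hx => ?_)
      have hl : 0 ≤ -Real.log x := neg_nonneg.2 (Real.log_nonpos hx.1.le hx.2)
      have : x ^ (2 * k + 1) ≤ x ^ (2 * k) :=
        pow_le_pow_of_le_one hx.1.le hx.2 (Nat.le_succ _)
      simp only [Pi.zero_apply]
      nlinarith
  simp only [hterm]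
  rw [← ENNReal.ofReal_tsum_of_nonneg _ hasSum_one_div_odd_sq_sub_even_sq.summable,
    hasSum_one_div_odd_sq_sub_even_sq.tsum_eq]
  intro k
  rw [sub_nonneg]
  gcongr
  norm_num

theorem lintegral_one_div_one_add :
    ∫⁻ x in Ioo (0 : ℝ) 1, ENNReal.ofReal (1 / (1 + x)) = ENNReal.ofReal (Real.log 2) := by
  have hder : ∀ x ∈ Ioo (0 : ℝ) 1, HasDerivAt (fun x => Real.log (1 + x)) (1 / (1 + x)) x :=
    fun x hx => ((hasDerivAt_id x).const_add 1).log (by have := hx.1; simp; linarith)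
  have hcont : ContinuousOn (fun x => Real.log (1 + x)) (Icc (0 : ℝ) 1) :=
    (continuousOn_const.add continuousOn_id).log fun x hx => by
      have := hx.1
      simp
      linarith
  have hnn : ∀ x ∈ Ioc (0 : ℝ) 1, 0 ≤ 1 / (1 + x) := fun x hx => by
    have := hx.1
    positivity
  have hint : IntegrableOn (fun x : ℝ => 1 / (1 + x)) (Ioc 0 1) :=
    intervalIntegral.integrableOn_deriv_of_nonneg hcont hder fun x hx =>
      hnn x (Ioo_subset_Ioc_self hx)
  have hval := intervalIntegral.integral_eq_sub_of_hasDerivAt_of_le zero_le_one hcont hder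
    ((intervalIntegrable_iff_integrableOn_Ioc_of_le zero_le_one).2 hint)
  rw [intervalIntegral.integral_of_le zero_le_one] at hval
  rw [restrict_Ioo_eq_restrict_Ioc, ← ofReal_integral_eq_lintegral_ofReal hint
    ((ae_restrict_iff' measurableSet_Ioc).2 (Eventually.of_forall hnn)), hval]
  norm_num

/-- The points of the unit interval with `log q_n < t` have measure bounded below, by Markov's
inequality for the Gauss measure. -/
theorem le_volume_log_qDen_lt (n : ℕ) {t : ℝ} (ht : 0 < t) :
    ENNReal.ofReal (Real.log 2 - n * (Real.pi ^ 2 / 12) / t)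
      ≤ volume {x : ℝ | x ∈ Ioo (0 : ℝ) 1 ∧ Irrational x ∧ Real.log (qDen n x) < t} := by
  set h : ℝ → ℝ≥0∞ := fun x => ENNReal.ofReal (1 / (1 + x)) with hh
  have hhm : Measurable h := by fun_prop
  have hqm := measurable_log_qDen n
  set good : Set ℝ := {x : ℝ | x ∈ Ioo (0 : ℝ) 1 ∧ Irrational x ∧ Real.log (qDen n x) < t}
  set bad : Set ℝ := {x : ℝ | t ≤ Real.log (qDen n x)}
  have hbad : MeasurableSet bad := measurableSet_le measurable_const hqm
  have hphi : Measurable fun x : ℝ => ENNReal.ofReal (-Real.log x) := by fun_prop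
  have hlog : ∫⁻ x in Ioo (0 : ℝ) 1, ENNReal.ofReal (Real.log (qDen n x)) * h x
      ≤ n * ENNReal.ofReal (Real.pi ^ 2 / 12) := by
    calc _ ≤ ∫⁻ x in Ioo (0 : ℝ) 1, ∑ i ∈ Finset.range n,
            ENNReal.ofReal (-Real.log (gaussMap^[i] x)) * h x := by
          refine lintegral_mono_ae ?_
          rw [ae_restrict_iff' measurableSet_Ioo]
          filter_upwards [ae_irrational] with x hx hx01
          have ho := isCFOrbit_of_irrational hx01 hx
          rw [← Finset.sum_mul, ← ENNReal.ofReal_sum_of_nonneg fun i _ =>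
            neg_nonneg.2 (Real.log_nonpos (ho i).1.1.le (ho i).1.2.le)]
          gcongr
          exact ho.log_contDen_le n
      _ = ∑ i ∈ Finset.range n, ∫⁻ x in Ioo (0 : ℝ) 1,
            ENNReal.ofReal (-Real.log (gaussMap^[i] x)) * h x :=
          lintegral_finsetSum _ fun i _ =>
            (hphi.comp (measurable_gaussMap.iterate i)).mul hhm
      _ ≤ ∑ i ∈ Finset.range n, ENNReal.ofReal (Real.pi ^ 2 / 12) :=
          Finset.sum_le_sum fun i _ =>
            (lintegral_comp_iterate_gaussMap_le hphi i).trans lintegral_neg_log_le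
      _ = _ := by simp
  have hmarkov : ∫⁻ x in bad ∩ Ioo (0 : ℝ) 1, h x
      ≤ ENNReal.ofReal (n * (Real.pi ^ 2 / 12) / t) := by
    rw [ENNReal.ofReal_div_of_pos ht, ENNReal.ofReal_mul (by positivity), ENNReal.ofReal_natCast,
      ENNReal.le_div_iff_mul_le (by simp [ht]) (by simp), ← lintegral_mul_const _ hhm]
    refine le_trans ?_ hlog
    refine le_trans ?_ (lintegral_mono_set (inter_subset_right : bad ∩ Ioo (0 : ℝ) 1 ⊆ _))
    refine setLIntegral_mono_ae (by fun_prop) (Eventually.of_forall fun x hx => ?_)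
    rw [mul_comm]
    gcongr
    exact hx.1
  have hgood : ∫⁻ x in badᶜ ∩ Ioo (0 : ℝ) 1, h x ≤ volume good := by
    calc _ ≤ ∫⁻ x in badᶜ ∩ Ioo (0 : ℝ) 1, 1 := by
          refine setLIntegral_mono_ae (by fun_prop) (Eventually.of_forall fun x hx => ?_)
          have := hx.2.1
          refine ENNReal.ofReal_le_one.2 ?_
          rw [div_le_one] <;> linarith
      _ = volume (badᶜ ∩ Ioo (0 : ℝ) 1) := setLIntegral_one _
      _ ≤ volume good := by
          refine measure_mono_ae ?_
          filter_upwards [ae_irrational] with x hx hx'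
          exact ⟨hx'.2, hx, not_le.1 hx'.1⟩
  have htot : ENNReal.ofReal (Real.log 2) ≤ volume good
      + ENNReal.ofReal (n * (Real.pi ^ 2 / 12) / t) := by
    rw [← lintegral_one_div_one_add, ← lintegral_inter_add_sdiff _ _ hbad, add_comm]
    refine add_le_add (le_trans (le_of_eq ?_) hgood) (le_trans (le_of_eq ?_) hmarkov)
    · rw [sdiff_eq, inter_comm]
    · rw [inter_comm]
  rw [ENNReal.ofReal_sub _ (by positivity)]
  exact tsub_le_iff_right.2 htot

end GaussMeasure

section UpperTail

open scoped ENNReal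

theorem exists_lt_volume_inter_digit_le {S : Set ℝ} {c : ℝ≥0∞} (n : ℕ) (h : c < volume S) :
    ∃ M₀, ∀ M ≥ M₀, c < volume (S ∩ {x | ∀ i < n, cfDigit x i ≤ M}) := by
  have hmono : Monotone fun M => S ∩ {x | ∀ i < n, cfDigit x i ≤ M} := fun M M' hM x hx =>
    ⟨hx.1, fun i hi => (hx.2 i hi).trans hM⟩
  have hU : ⋃ M, S ∩ {x | ∀ i < n, cfDigit x i ≤ M} = S := by
    refine Subset.antisymm (iUnion_subset fun M => inter_subset_left) fun x hx => ?_
    exact mem_iUnion.2 ⟨(Finset.range n).sup (cfDigit x), hx, fun i hi =>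
      Finset.le_sup (f := cfDigit x) (Finset.mem_range.2 hi)⟩
  rw [← hU, hmono.measure_iUnion, lt_iSup_iff] at h
  obtain ⟨M₀, hM₀⟩ := h
  exact ⟨M₀, fun M hM => hM₀.trans_le (measure_mono (hmono hM))⟩

theorem measurableSet_digit_le (n M : ℕ) :
    MeasurableSet {x : ℝ | ∀ i < n, cfDigit x i ≤ M} := by
  simp only [ofPred_forall]
  exact MeasurableSet.iInter fun i => MeasurableSet.iInter fun _ =>
    measurableSet_le (measurable_cfDigit i) measurable_const

theorem one_le_qDen {x : ℝ} (hx : x ∈ Ioo (0 : ℝ) 1) (hirr : Irrational x) (n : ℕ) :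
    (1 : ℝ) ≤ qDen n x :=
  Nat.one_le_cast.2 (contDen_pos (isCFOrbit_of_irrational hx hirr).one_le_digit n)

/-- If `q_n` is at least `exp (n α / 2)`, respectively at most half of that, with probability
larger than `exp (n R)`, then `L(α)` has dimension almost `1 + R / α`. -/
theorem le_dimH_levelSet_of_lt_volume {α R : ℝ} {n : ℕ} (hα : 0 < α) (hR : R < 0) (hn : 0 < n)
    (hA : ENNReal.ofReal (Real.exp (n * R)) < volume {x : ℝ | x ∈ Ioo (0 : ℝ) 1 ∧ Irrational x ∧
      α ≤ 2 / (n : ℝ) * Real.log (qDen n x)})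
    (hB : ENNReal.ofReal (Real.exp (n * R)) < volume {x : ℝ | x ∈ Ioo (0 : ℝ) 1 ∧ Irrational x ∧
      Real.log (qDen n x) < n * α / 2 - Real.log 2})
    (hs : 0 < 1 + R / α - Real.log 4 / (n * α)) :
    ENNReal.ofReal (1 + R / α - Real.log 4 / (n * α)) ≤ dimH (levelSet (α : EReal)) := by
  have hn' : (0 : ℝ) < n := Nat.cast_pos.2 hn
  obtain ⟨M₁, hM₁⟩ := exists_lt_volume_inter_digit_le n hA
  obtain ⟨M₂, hM₂⟩ := exists_lt_volume_inter_digit_le n hB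
  have hAM := hM₁ _ (le_max_left M₁ M₂)
  have hBM := hM₂ _ (le_max_right M₁ M₂)
  set M := max M₁ M₂
  have hpair : IsBlockPair n (Real.exp (n * α / 2)) M
      ({x : ℝ | x ∈ Ioo (0 : ℝ) 1 ∧ Irrational x ∧ α ≤ 2 / (n : ℝ) * Real.log (qDen n x)} ∩
        {x | ∀ i < n, cfDigit x i ≤ M})
      ({x : ℝ | x ∈ Ioo (0 : ℝ) 1 ∧ Irrational x ∧
        Real.log (qDen n x) < n * α / 2 - Real.log 2} ∩ {x | ∀ i < n, cfDigit x i ≤ M}) :=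
    { pos := hn
      one_lt := Real.one_lt_exp_iff.2 (by positivity)
      left_irrational := fun x hx => ⟨hx.1.1, hx.1.2.1⟩
      right_irrational := fun x hx => ⟨hx.1.1, hx.1.2.1⟩
      left_digit_le := fun x hx => hx.2
      right_digit_le := fun x hx => hx.2
      le_qDen := fun x hx => by
        have hq := one_le_qDen hx.1.1 hx.1.2.1 n
        rw [← Real.le_log_iff_exp_le (by linarith)]
        have := hx.1.2.2
        rw [div_mul_eq_mul_div, le_div_iff₀ hn'] at this
        linarith
      qDen_le := fun x hx => by
        have hq := one_le_qDen hx.1.1 hx.1.2.1 n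
        rw [← Real.log_le_iff_le_exp (by linarith), Real.log_mul (by norm_num) (by linarith)]
        linarith [hx.1.2.2] }
  have hfin : ∀ p : ℝ → Prop, ∀ s : Set ℝ,
      volume ({x : ℝ | x ∈ Ioo (0 : ℝ) 1 ∧ Irrational x ∧ p x} ∩ s) ≠ ∞ := fun p s =>
    measure_ne_top_of_subset (fun x hx => hx.1.1 : _ ⊆ Ioo (0 : ℝ) 1) measure_Ioo_lt_top.ne
  have hmeas : ∀ p : ℝ → Prop, MeasurableSet {x | p x} →
      MeasurableSet ({x : ℝ | x ∈ Ioo (0 : ℝ) 1 ∧ Irrational x ∧ p x} ∩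
        {x | ∀ i < n, cfDigit x i ≤ M}) := fun p hp =>
    (measurableSet_Ioo.inter (measurableSet_irrational.inter hp)).inter
      (measurableSet_digit_le n M)
  have h4 : 0 < Real.log 4 := Real.log_pos (by norm_num)
  have hκ : 1 - (Real.log 4 - n * R) * 2 / (n * α) / 2 = 1 + R / α - Real.log 4 / (n * α) := by
    field_simp
    ring
  rw [← hκ] at hs ⊢
  refine hpair.le_dimH_levelSet hα (Real.exp_pos (n * R)) ?_ ?_ (by linarith)
    (hmeas _ (measurableSet_le measurable_const (measurable_const.mul (measurable_log_qDen n))))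
    (hmeas _ (measurableSet_lt (measurable_log_qDen n) measurable_const))
    hAM.le hBM.le (hfin _ _) (hfin _ _)
  · rw [← Real.exp_mul]
    have : (n * α / 2) * ((Real.log 4 - n * R) * 2 / (n * α)) = Real.log 4 - n * R := by
      field_simp
    rw [this, Real.exp_sub, Real.exp_log (by norm_num)]
  · have : n * R < 0 := mul_neg_of_pos_of_neg hn' hR
    have : 0 ≤ Real.log 4 - n * R := by linarith
    positivity

theorem volume_le_log_qDen_pos {α : ℝ} {n : ℕ} (hn : 0 < n) :
    0 < volume {x : ℝ | x ∈ Ioo (0 : ℝ) 1 ∧ Irrational x ∧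
      α ≤ 2 / (n : ℝ) * Real.log (qDen n x)} := by
  have hn' : (0 : ℝ) < n := Nat.cast_pos.2 hn
  set θ := Real.exp (n * α / 2)
  have hθ : 0 < θ := Real.exp_pos _
  have hpos : 0 < volume (Ioo (0 : ℝ) (1 / (θ + 1))) := by
    rw [Real.volume_Ioo]
    exact ENNReal.ofReal_pos.2 (by rw [sub_zero]; positivity)
  refine hpos.trans_le (measure_mono_ae ?_)
  filter_upwards [ae_irrational] with x hx hx'
  have hx1 : x < 1 := hx'.2.trans (by rw [div_lt_one] <;> linarith)
  have hx01 : x ∈ Ioo (0 : ℝ) 1 := ⟨hx'.1, hx1⟩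
  refine ⟨hx01, hx, ?_⟩
  have hd : θ ≤ cfDigit x 0 := by
    have h1 : θ + 1 < 1 / x := by
      rw [lt_div_iff₀ hx'.1, ← lt_div_iff₀' (by positivity)]
      exact hx'.2
    have h2 : 1 / x < cfDigit x 0 + 1 := Nat.lt_floor_add_one (1 / x)
    linarith
  have hq : (cfDigit x 0 : ℝ) ≤ qDen n x :=
    Nat.cast_le.2 (contDen_monotone (isCFOrbit_of_irrational hx01 hx).one_le_digit hn)
  have := (Real.le_log_iff_exp_le (hθ.trans_le (hd.trans hq))).2 (hd.trans hq)
  rw [div_mul_eq_mul_div, le_div_iff₀ hn']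
  linarith

theorem dimH_levelSet_ne_top (α : EReal) : dimH (levelSet α) ≠ ∞ :=
  ((dimH_mono (subset_univ _)).trans_lt (Real.dimH_univ.trans_lt ENNReal.one_lt_top)).ne

theorem levyConst_pos : 0 < levyConst := by
  have := Real.log_pos one_lt_two
  unfold levyConst
  positivity

/-- If `2γ < α`, the points with `q_n < exp (n α / 2) / 2` have measure bounded away from zero. -/
theorem eventually_lt_volume_log_qDen_lt {α R : ℝ} (hα : 2 * levyConst < α) (hR : R < 0) :
    ∀ᶠ n : ℕ in atTop, ENNReal.ofReal (Real.exp (n * R)) <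
      volume {x : ℝ | x ∈ Ioo (0 : ℝ) 1 ∧ Irrational x ∧
        Real.log (qDen n x) < n * α / 2 - Real.log 2} := by
  have hl : 0 < Real.log 2 := Real.log_pos one_lt_two
  have hα0 : 0 < α := by linarith [levyConst_pos]
  have hc : 0 < Real.log 2 - Real.pi ^ 2 / 12 / (α / 2) := by
    have : Real.pi ^ 2 / 12 = levyConst * Real.log 2 := by
      unfold levyConst
      field_simp
    rw [this, sub_pos, div_lt_iff₀ (by positivity)]
    nlinarith
  have hexp : Tendsto (fun n : ℕ => Real.exp (n * R)) atTop (𝓝 0) :=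
    Real.tendsto_exp_atBot.comp (tendsto_natCast_atTop_atTop.atTop_mul_const_of_neg hR)
  have hlim : Tendsto (fun n : ℕ => Real.log 2 -
      Real.pi ^ 2 / 12 / (α / 2 - Real.log 2 / (n : ℝ))) atTop
      (𝓝 (Real.log 2 - Real.pi ^ 2 / 12 / (α / 2 - 0))) :=
    tendsto_const_nhds.sub (tendsto_const_nhds.div (tendsto_const_nhds.sub
      (tendsto_const_div_atTop_nhds_zero_nat _)) (by simpa using hα0.ne'))
  have hpos : Tendsto (fun n : ℕ => α / 2 - Real.log 2 / (n : ℝ)) atTop (𝓝 (α / 2 - 0)) :=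
    tendsto_const_nhds.sub (tendsto_const_div_atTop_nhds_zero_nat _)
  rw [sub_zero] at hlim hpos
  filter_upwards [eventually_gt_atTop 0, hexp.eventually_lt hlim hc,
    hpos.eventually_const_lt (half_pos hα0)] with n hn h1 h2
  have hn' : (0 : ℝ) < n := Nat.cast_pos.2 hn
  have ht : n * α / 2 - Real.log 2 = n * (α / 2 - Real.log 2 / n) := by
    field_simp
  have ht0 : 0 < n * α / 2 - Real.log 2 := ht ▸ mul_pos hn' h2
  refine lt_of_lt_of_le ?_ (le_volume_log_qDen_lt n ht0)
  rw [ENNReal.ofReal_lt_ofReal_iff', ht, mul_div_mul_left _ _ hn'.ne']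
  exact ⟨h1, (Real.exp_pos _).trans h1⟩

end UpperTail

/-- For every `α ∈ (2γ, ∞)`,
`limsup (1/n) log λ{x ∈ (0,1) irrational : (2/n) log q_n(x) ≥ α} ≤ -I(α)`. -/
theorem limsup_upper_tail (α : ℝ) (hα : 2 * levyConst < α) :
    Filter.limsup (fun n : ℕ =>
        ((1 / (n : ℝ) * Real.log
          ((volume {x : ℝ | x ∈ Set.Ioo (0 : ℝ) 1 ∧ Irrational x ∧
            α ≤ 2 / (n : ℝ) * Real.log (qDen n x)}).toReal) : ℝ) : EReal))
      Filter.atTop ≤ ((-(rateI α) : ℝ) : EReal) := by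
  have hα0 : 0 < α := by linarith [levyConst_pos]
  by_contra hcon
  rw [not_le, EReal.lt_iff_exists_real_btwn] at hcon
  obtain ⟨R, hIR, hR⟩ := hcon
  rw [EReal.coe_lt_coe_iff] at hIR
  have hfreq := frequently_lt_of_lt_limsup (by isBoundedDefault) hR
  simp only [EReal.coe_lt_coe_iff] at hfreq
  have key : ∀ n : ℕ, 0 < n → R < 1 / (n : ℝ) * Real.log
      ((volume {x : ℝ | x ∈ Set.Ioo (0 : ℝ) 1 ∧ Irrational x ∧
        α ≤ 2 / (n : ℝ) * Real.log (qDen n x)}).toReal) →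
      R < 0 ∧ ENNReal.ofReal (Real.exp (n * R)) < volume {x : ℝ | x ∈ Set.Ioo (0 : ℝ) 1 ∧
        Irrational x ∧ α ≤ 2 / (n : ℝ) * Real.log (qDen n x)} := by
    intro n hn h
    have hn' : (0 : ℝ) < n := Nat.cast_pos.2 hn
    have hv0 := volume_le_log_qDen_pos (α := α) hn
    set v := volume {x : ℝ | x ∈ Set.Ioo (0 : ℝ) 1 ∧ Irrational x ∧
      α ≤ 2 / (n : ℝ) * Real.log (qDen n x)}
    have hv1 : v ≤ 1 :=
      (measure_mono fun x hx => hx.1 : v ≤ volume (Ioo (0 : ℝ) 1)).trans_eq (by simp)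
    have hvt : v ≠ ⊤ := (hv1.trans_lt ENNReal.one_lt_top).ne
    have hvr : 0 < v.toReal := ENNReal.toReal_pos hv0.ne' hvt
    have hvr1 : v.toReal ≤ 1 := ENNReal.toReal_le_of_le_ofReal zero_le_one (by simpa using hv1)
    rw [one_div_mul_eq_div, lt_div_iff₀' hn', Real.lt_log_iff_exp_lt hvr] at h
    refine ⟨?_, (ENNReal.ofReal_lt_iff_lt_toReal (Real.exp_pos _).le hvt).2 h⟩
    by_contra! hR0
    exact absurd (h.trans_le hvr1) (not_lt.2 (Real.one_le_exp (by positivity)))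
  have hR0 : R < 0 := by
    obtain ⟨n, h, hn⟩ := (hfreq.and_eventually (eventually_gt_atTop 0)).exists
    exact (key n hn h).1
  have hb0 : 0 ≤ dimSpec α := ENNReal.toReal_nonneg
  have hb : dimSpec α < 1 + R / α - 0 := by
    have : -(1 - dimSpec α) < R / α := by
      rw [lt_div_iff₀ hα0]
      unfold rateI at hIR
      linarith
    linarith
  have hs : Tendsto (fun n : ℕ => 1 + R / α - Real.log 4 / α / (n : ℝ)) atTop
      (𝓝 (1 + R / α - 0)) :=
    tendsto_const_nhds.sub (tendsto_const_div_atTop_nhds_zero_nat _)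
  obtain ⟨n, hRn, hn, hBn, hsn⟩ := (hfreq.and_eventually ((eventually_gt_atTop 0).and
    ((eventually_lt_volume_log_qDen_lt hα hR0).and (hs.eventually_const_lt hb)))).exists
  rw [div_div, mul_comm α] at hsn
  have hdim := le_dimH_levelSet_of_lt_volume hα0 hR0 hn (key n hn hRn).2 hBn (hb0.trans_lt hsn)
  exact hsn.not_ge ((ENNReal.ofReal_le_iff_le_toReal (dimH_levelSet_ne_top _)).1 hdim)
end

section
/- For every integer n ≥ 1, every rank-n cylinder A, and all irrational x, y ∈ A, the derivatives of the n-th iterate of the Gauss map satisfy DT^n(x)/DT^n(y) ≤ e^{16}. -/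
open Filter MeasureTheory Set

/-- The rank-`n` cylinder: irrationals in `(0,1)` whose first `n`
continued fraction digits are `a 0, …, a (n-1)`. -/
noncomputable def cylinder (n : ℕ) (a : ℕ → ℕ) : Set ℝ :=
  {x | x ∈ Set.Ioo (0 : ℝ) 1 ∧ Irrational x ∧ ∀ i < n, cfDigit x i = a i}

/-- The Gauss map preserves the irrationals. -/
theorem irrational_gaussMap {x : ℝ} (hx : Irrational x) : Irrational (gaussMap x) := by
  unfold gaussMap
  rw [Int.fract, one_div]
  exact hx.inv.sub_intCast _

theorem irrational_iterate_gaussMap {x : ℝ} (hx : Irrational x) (n : ℕ) :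
    Irrational (gaussMap^[n] x) := by
  induction n with
  | zero => exact hx
  | succ n ih => rw [Function.iterate_succ_apply']; exact irrational_gaussMap ih

theorem iterate_gaussMap_mem_Ioo {x : ℝ} (hx : Irrational x) (h : x ∈ Ioo (0 : ℝ) 1) (n : ℕ) :
    gaussMap^[n] x ∈ Ioo (0 : ℝ) 1 := by
  cases n with
  | zero => exact h
  | succ n =>
    have hne := (irrational_iterate_gaussMap hx (n + 1)).ne_zero
    rw [Function.iterate_succ_apply'] at hne ⊢
    exact ⟨lt_of_le_of_ne (Int.fract_nonneg _) hne.symm, Int.fract_lt_one _⟩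

/-- Off the integers, the fractional part has derivative one. -/
theorem hasDerivAt_fract_of_irrational {x : ℝ} (hx : Irrational x) :
    HasDerivAt (Int.fract : ℝ → ℝ) 1 x := by
  have hlt : (⌊x⌋ : ℝ) < x := lt_of_le_of_ne (Int.floor_le x) (hx.ne_int _).symm
  refine ((hasDerivAt_id x).sub_const (⌊x⌋ : ℝ)).congr_of_eventuallyEq ?_
  filter_upwards [Ioo_mem_nhds hlt (Int.lt_floor_add_one x)] with y hy
  have hfl : ⌊y⌋ = ⌊x⌋ := Int.floor_eq_iff.2 ⟨hy.1.le, hy.2⟩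
  simp [Int.fract, hfl]

theorem hasDerivAt_gaussMap {x : ℝ} (hx : Irrational x) :
    HasDerivAt gaussMap (-(x ^ 2)⁻¹) x := by
  have h := (hasDerivAt_fract_of_irrational hx.inv).comp x (hasDerivAt_inv hx.ne_zero)
  rw [one_mul] at h
  refine h.congr_of_eventuallyEq (Eventually.of_forall fun y => ?_)
  simp [gaussMap]

/-- The derivative of an iterate of the Gauss map, in terms of the product along the orbit. -/
theorem hasDerivAt_iterate_gaussMap {x : ℝ} (hx : Irrational x) (n : ℕ) :
    HasDerivAt (gaussMap^[n])
      ((-1) ^ n * ((∏ i ∈ Finset.range n, gaussMap^[i] x) ^ 2)⁻¹) x := by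
  induction n with
  | zero => simpa using hasDerivAt_id x
  | succ n ih =>
    have h := (hasDerivAt_gaussMap (irrational_iterate_gaussMap hx n)).comp x ih
    rw [Function.iterate_succ']
    refine h.congr_deriv ?_
    rw [Finset.prod_range_succ, mul_pow, mul_inv, pow_succ]
    ring

/-- Along a cylinder, the reciprocal of the product along the orbit is `q + r * T^n x`, where
`0 ≤ r ≤ q` depend only on the cylinder. -/
theorem exists_prod_iterate_gaussMap_mul_eq_one (n : ℕ) (a : ℕ → ℕ) (ha : ∀ i < n, 1 ≤ a i) :
    ∃ q r : ℝ, 0 < q ∧ 0 ≤ r ∧ r ≤ q ∧ ∀ x ∈ cylinder n a,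
      (∏ i ∈ Finset.range n, gaussMap^[i] x) * (q + r * gaussMap^[n] x) = 1 := by
  induction n with
  | zero => exact ⟨1, 0, by simp⟩
  | succ n ih =>
    obtain ⟨q, r, hq, hr, hrq, h⟩ := ih fun i hi => ha i (by omega)
    have han : (1 : ℝ) ≤ a n := by exact_mod_cast ha n (by omega)
    refine ⟨q * a n + r, q, by positivity, hq.le, by nlinarith, fun x hx => ?_⟩
    have hx' := h x ⟨hx.1, hx.2.1, fun i hi => hx.2.2 i (by omega)⟩
    have ht := (iterate_gaussMap_mem_Ioo hx.2.1 hx.1 n).1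
    have hd : ⌊1 / gaussMap^[n] x⌋₊ = a n := hx.2.2 n (by omega)
    have hT : gaussMap^[n + 1] x = 1 / gaussMap^[n] x - a n := by
      rw [Function.iterate_succ_apply', ← hd, natCast_floor_eq_intCast_floor (by positivity)]
      rfl
    rw [Finset.prod_range_succ, hT]
    linear_combination hx' + (∏ i ∈ Finset.range n, gaussMap^[i] x) * q *
      mul_one_div_cancel ht.ne'

/-- Bounded distortion: for every `n ≥ 1`, every rank-`n` cylinder `A`, and all irrational
`x, y ∈ A`, `DT^n(x)/DT^n(y) ≤ e^16`. -/
theorem cylinder_distortion (n : ℕ) (hn : 1 ≤ n) (a : ℕ → ℕ) (ha : ∀ i < n, 1 ≤ a i)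
    (x y : ℝ) (hx : x ∈ cylinder n a) (hy : y ∈ cylinder n a) :
    deriv (gaussMap^[n]) x / deriv (gaussMap^[n]) y ≤ Real.exp 16 := by
  obtain ⟨q, r, hq, hr, hrq, h⟩ := exists_prod_iterate_gaussMap_mul_eq_one n a ha
  rw [(hasDerivAt_iterate_gaussMap hx.2.1 n).deriv, (hasDerivAt_iterate_gaussMap hy.2.1 n).deriv,
    mul_div_mul_left _ _ (pow_ne_zero n (by norm_num : (-1 : ℝ) ≠ 0)),
    ← inv_pow, ← inv_pow, inv_eq_of_mul_eq_one_right (h x hx),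
    inv_eq_of_mul_eq_one_right (h y hy), ← div_pow]
  obtain ⟨hx0, hx1⟩ := iterate_gaussMap_mem_Ioo hx.2.1 hx.1 n
  obtain ⟨hy0, hy1⟩ := iterate_gaussMap_mem_Ioo hy.2.1 hy.1 n
  have hle : (q + r * gaussMap^[n] x) / (q + r * gaussMap^[n] y) ≤ 2 := by
    rw [div_le_iff₀ (by positivity)]
    nlinarith [mul_nonneg hr hy0.le, mul_le_mul_of_nonneg_left hx1.le hr]
  calc ((q + r * gaussMap^[n] x) / (q + r * gaussMap^[n] y)) ^ 2
      ≤ 2 ^ 2 := pow_le_pow_left₀ (by positivity) hle 2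
    _ ≤ 16 + 1 := by norm_num
    _ ≤ Real.exp 16 := Real.add_one_le_exp 16
end
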